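/- arXiv:1906.11965 — 7 statements merged into one kernel-verified Lean document; each statement's English description precedes it below -/
import Mathlib

section
/- Every face of an isosceles tetrahedron is an acute triangle: for any three pairwise distinct vertices u, v, w among {a, b, c, d}, ∠ u v w < π/2. -/
open EuclideanGeometry Real

section Isosceles

variable {V : Type*} [NormedAddCommGroup V] [InnerProductSpace ℝ V]

/-- Four times the inner product of two edges of an isosceles tetrahedron at a common vertex is the
squared norm of twice the corresponding bimedian. -/
lemma four_mul_inner_sub_sub_eq_norm_sq {a b c d : V}
    (h1 : dist a b = dist c d) (h2 : dist a c = dist b d) (h3 : dist a d = dist b c) :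
    4 * inner ℝ (b - a) (c - a) = ‖(b + c) - (a + d)‖ ^ 2 := by
  have e1 : ‖b - a‖ ^ 2 = ‖(c - a) - (d - a)‖ ^ 2 := by
    rw [sub_sub_sub_cancel_right, ← dist_eq_norm, ← dist_eq_norm, dist_comm, h1]
  have e2 : ‖c - a‖ ^ 2 = ‖(b - a) - (d - a)‖ ^ 2 := by
    rw [sub_sub_sub_cancel_right, ← dist_eq_norm, ← dist_eq_norm, dist_comm, h2]
  have e3 : ‖d - a‖ ^ 2 = ‖(b - a) - (c - a)‖ ^ 2 := by
    rw [sub_sub_sub_cancel_right, ← dist_eq_norm, ← dist_eq_norm, dist_comm, h3]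
  have e : (b + c) - (a + d) = (b - a) + (c - a) - (d - a) := by abel
  rw [e, norm_sub_sq_real, norm_add_sq_real, inner_add_left]
  rw [norm_sub_sq_real (c - a)] at e1
  rw [norm_sub_sq_real (b - a)] at e2 e3
  linarith

/-- A face angle of an isosceles tetrahedron is acute unless the four vertices form a
parallelogram. -/
lemma angle_lt_pi_div_two_of_isosceles {a b c d : V}
    (h1 : dist a b = dist c d) (h2 : dist a c = dist b d) (h3 : dist a d = dist b c)
    (h : b + c ≠ a + d) : ∠ b a c < π / 2 := by
  have hpos : 0 < ‖(b + c) - (a + d)‖ ^ 2 := pow_pos (norm_pos_iff.2 (sub_ne_zero.2 h)) 2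
  rw [← four_mul_inner_sub_sub_eq_norm_sq h1 h2 h3] at hpos
  exact Real.arccos_lt_pi_div_two.2 (div_pos (by simpa using hpos) (mul_pos
    (norm_pos_iff.2 fun h0 => by simp_all) (norm_pos_iff.2 fun h0 => by simp_all)))

/-- All face angles at the vertex `a` of an isosceles tetrahedron are acute. -/
lemma angle_lt_pi_div_two_of_isosceles_of_mem {a b c d u w : V}
    (h1 : dist a b = dist c d) (h2 : dist a c = dist b d) (h3 : dist a d = dist b c)
    (n1 : a + b ≠ c + d) (n2 : a + c ≠ b + d) (n3 : a + d ≠ b + c)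
    (hu : u = a ∨ u = b ∨ u = c ∨ u = d) (hw : w = a ∨ w = b ∨ w = c ∨ w = d)
    (hua : u ≠ a) (hwa : a ≠ w) (huw : u ≠ w) : ∠ u a w < π / 2 := by
  have hbc : ∠ b a c < π / 2 := angle_lt_pi_div_two_of_isosceles h1 h2 h3 n3.symm
  have hbd : ∠ b a d < π / 2 :=
    angle_lt_pi_div_two_of_isosceles (h1.trans (dist_comm _ _)) h3 h2 n2.symm
  have hcd : ∠ c a d < π / 2 :=
    angle_lt_pi_div_two_of_isosceles (h2.trans (dist_comm _ _)) (h3.trans (dist_comm _ _)) h1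
      n1.symm
  rcases hu with rfl | rfl | rfl | rfl <;> rcases hw with rfl | rfl | rfl | rfl <;>
    first
    | contradiction
    | assumption
    | (rw [EuclideanGeometry.angle_comm]; assumption)

/-- The coefficients of an affine relation between four affinely independent points vanish. -/
lemma AffineIndependent.eq_zero_of_smul_add_eq_zero {a b c d : V}
    (hind : AffineIndependent ℝ ![a, b, c, d]) {x y z t : ℝ} (hsum : x + y + z + t = 0)
    (h : x • a + y • b + z • c + t • d = 0) : x = 0 := by
  have := affineIndependent_iff.1 hind Finset.univ ![x, y, z, t]
    (by simpa [Fin.sum_univ_four] using hsum) (by simpa [Fin.sum_univ_four] using h)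
    0 (Finset.mem_univ _)
  simpa using this

end Isosceles

theorem stmt10 (a b c d : EuclideanSpace ℝ (Fin 3))
    (hind : AffineIndependent ℝ ![a, b, c, d])
    (h1 : dist a b = dist c d) (h2 : dist a c = dist b d) (h3 : dist a d = dist b c) :
    ∀ u v w : EuclideanSpace ℝ (Fin 3),
      u ∈ ({a, b, c, d} : Set (EuclideanSpace ℝ (Fin 3))) →
      v ∈ ({a, b, c, d} : Set (EuclideanSpace ℝ (Fin 3))) →
      w ∈ ({a, b, c, d} : Set (EuclideanSpace ℝ (Fin 3))) →
      u ≠ v → v ≠ w → u ≠ w → ∠ u v w < π / 2 := by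
  have n1 : a + b ≠ c + d := fun h => one_ne_zero <|
    hind.eq_zero_of_smul_add_eq_zero (x := 1) (y := 1) (z := -1) (t := -1) (by norm_num)
      (by rw [← sub_eq_zero] at h; rw [← h]; module)
  have n2 : a + c ≠ b + d := fun h => one_ne_zero <|
    hind.eq_zero_of_smul_add_eq_zero (x := 1) (y := -1) (z := 1) (t := -1) (by norm_num)
      (by rw [← sub_eq_zero] at h; rw [← h]; module)
  have n3 : a + d ≠ b + c := fun h => one_ne_zero <|
    hind.eq_zero_of_smul_add_eq_zero (x := 1) (y := -1) (z := -1) (t := 1) (by norm_num)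
      (by rw [← sub_eq_zero] at h; rw [← h]; module)
  intro u v w hu hv hw huv hvw huw
  simp only [Set.mem_insert_iff, Set.mem_singleton_iff] at hu hw
  rcases hv with rfl | rfl | rfl | rfl
  · exact angle_lt_pi_div_two_of_isosceles_of_mem h1 h2 h3 n1 n2 n3 hu hw huv hvw huw
  · exact angle_lt_pi_div_two_of_isosceles_of_mem (b := a) (c := d) (d := c)
      (by simpa only [dist_comm] using h1) h2.symm h3.symm
      (by simpa only [add_comm] using n1) n2.symm n3.symm
      (by tauto) (by tauto) huv hvw huw
  · exact angle_lt_pi_div_two_of_isosceles_of_mem (b := d) (c := a) (d := b)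
      h1.symm (by simpa only [dist_comm] using h2) (by simpa only [dist_comm] using h3.symm)
      n1.symm (by simpa only [add_comm] using n2) (by simpa only [add_comm] using n3.symm)
      (by tauto) (by tauto) huv hvw huw
  · exact angle_lt_pi_div_two_of_isosceles_of_mem (b := c) (c := b) (d := a)
      (by simpa only [dist_comm] using h1.symm) (by simpa only [dist_comm] using h2.symm)
      (by simpa only [dist_comm] using h3) (by simpa only [add_comm] using n1.symm)
      (by simpa only [add_comm] using n2.symm) (by simpa only [add_comm] using n3)
      (by tauto) (by tauto) huv hvw huw
end

section
/- Let O ∈ E2, R > 0, and let A, B, C ∈ E2 be pairwise distinct points with dist O A = dist O B = dist O C = R, forming an acute triangle: ∠ B A C < π/2, ∠ A B C < π/2, and ∠ A C B < π/2. Then the longest side has length at least √3 · R, i.e. max (dist A B) (max (dist B C) (dist C A)) ≥ √3 · R, with equality if and only if the triangle is equilateral: dist A B = dist B C = dist C A. -/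
open EuclideanGeometry Real

/-- The squared side lengths of a triangle inscribed in a planar circle of radius `R`:
`(abc)² = R² · 16 S²`, with Heron's formula for the area `S`. -/
theorem sq_dist_mul_eq_sq_circumradius_mul (O A B C : EuclideanSpace ℝ (Fin 2)) (R : ℝ)
    (hA : dist O A = R) (hB : dist O B = R) (hC : dist O C = R) :
    dist A B ^ 2 * dist B C ^ 2 * dist C A ^ 2 =
      R ^ 2 * (2 * dist A B ^ 2 * (dist B C ^ 2 + dist C A ^ 2) - (dist A B ^ 2) ^ 2
        - (dist B C ^ 2 - dist C A ^ 2) ^ 2) := by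
  have dist_sq (P Q : EuclideanSpace ℝ (Fin 2)) :
      dist P Q ^ 2 = (P 0 - Q 0) ^ 2 + (P 1 - Q 1) ^ 2 := by
    rw [EuclideanSpace.dist_eq, Real.sq_sqrt (by positivity)]
    simp [Fin.sum_univ_two, Real.dist_eq, sq_abs]
  have ha := dist_sq O A
  have hb := dist_sq O B
  have hc := dist_sq O C
  rw [hA] at ha
  rw [hB] at hb
  rw [hC] at hc
  generalize R ^ 2 = r at *
  obtain ⟨a, ea⟩ : ∃ a, a = A 0 - O 0 := ⟨_, rfl⟩
  obtain ⟨a', ea'⟩ : ∃ a, a = A 1 - O 1 := ⟨_, rfl⟩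
  obtain ⟨b, eb⟩ : ∃ a, a = B 0 - O 0 := ⟨_, rfl⟩
  obtain ⟨b', eb'⟩ : ∃ a, a = B 1 - O 1 := ⟨_, rfl⟩
  obtain ⟨c, ec⟩ : ∃ a, a = C 0 - O 0 := ⟨_, rfl⟩
  obtain ⟨c', ec'⟩ : ∃ a, a = C 1 - O 1 := ⟨_, rfl⟩
  have hr₁ : a ^ 2 + a' ^ 2 = r := by rw [ha, ea, ea']; ring
  have hr₂ : b ^ 2 + b' ^ 2 = r := by rw [hb, eb, eb']; ring
  have hr₃ : c ^ 2 + c' ^ 2 = r := by rw [hc, ec, ec']; ring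
  obtain ⟨p, hp⟩ : ∃ p, p = a * b + a' * b' := ⟨_, rfl⟩
  obtain ⟨q, hq⟩ : ∃ p, p = b * c + b' * c' := ⟨_, rfl⟩
  obtain ⟨s, hs⟩ : ∃ p, p = c * a + c' * a' := ⟨_, rfl⟩
  have hAB : dist A B ^ 2 = 2 * (r - p) := by
    rw [dist_sq]
    have : (A 0 - B 0) ^ 2 + (A 1 - B 1) ^ 2 = (a - b) ^ 2 + (a' - b') ^ 2 := by
      rw [ea, ea', eb, eb']; ring
    rw [this]
    linear_combination hr₁ + hr₂ + 2 * hp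
  have hBC : dist B C ^ 2 = 2 * (r - q) := by
    rw [dist_sq]
    have : (B 0 - C 0) ^ 2 + (B 1 - C 1) ^ 2 = (b - c) ^ 2 + (b' - c') ^ 2 := by
      rw [eb, eb', ec, ec']; ring
    rw [this]
    linear_combination hr₂ + hr₃ + 2 * hq
  have hCA : dist C A ^ 2 = 2 * (r - s) := by
    rw [dist_sq]
    have : (C 0 - A 0) ^ 2 + (C 1 - A 1) ^ 2 = (c - a) ^ 2 + (c' - a') ^ 2 := by
      rw [ec, ec', ea, ea']; ring
    rw [this]
    linear_combination hr₃ + hr₁ + 2 * hs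
  have gram : r * r * r + 2 * p * q * s - r * q ^ 2 - r * s ^ 2 - r * p ^ 2 = 0 := by
    have : (a ^ 2 + a' ^ 2) * (b ^ 2 + b' ^ 2) * (c ^ 2 + c' ^ 2) + 2 * p * q * s
        - (a ^ 2 + a' ^ 2) * q ^ 2 - (b ^ 2 + b' ^ 2) * s ^ 2 - (c ^ 2 + c' ^ 2) * p ^ 2 = 0 := by
      rw [hp, hq, hs]; ring
    rwa [hr₁, hr₂, hr₃] at this
  rw [hAB, hBC, hCA]
  linear_combination (-4) * gram

/-- In a triangle with an acute angle at `P`, the opposite side is shorter than Pythagoras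
would give. -/
theorem sq_dist_lt_of_angle_lt_pi_div_two {P Q S : EuclideanSpace ℝ (Fin 2)}
    (hQ : Q ≠ P) (hS : S ≠ P) (h : ∠ Q P S < π / 2) :
    dist Q S ^ 2 < dist Q P ^ 2 + dist S P ^ 2 := by
  have hcos : 0 < Real.cos (∠ Q P S) :=
    Real.cos_pos_of_mem_Ioo ⟨by linarith [Real.pi_pos, angle_nonneg Q P S], h⟩
  have := dist_sq_eq_dist_sq_add_dist_sq_sub_two_mul_dist_mul_dist_mul_cos_angle Q P S
  have := mul_pos (mul_pos (dist_pos.2 hQ) (dist_pos.2 hS)) hcos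
  nlinarith

/-- If the longest side of an acute triangle has squared length `x ≤ 3r`, where `r` is the squared
circumradius, then the triangle is equilateral. -/
theorem eq_and_eq_of_le_three_mul {x y z r : ℝ} (hx : 0 < x) (hy : 0 < y) (hz : 0 < z)
    (hr : 0 < r) (hyx : y ≤ x) (hzx : z ≤ x) (hacute : x < y + z)
    (h : x * y * z = r * (2 * x * (y + z) - x ^ 2 - (y - z) ^ 2)) (hxr : x ≤ 3 * r) :
    x = y ∧ y = z := by
  have hQ : 0 < 2 * x * (y + z) - x ^ 2 - (y - z) ^ 2 := by
    have : 0 < r * (2 * x * (y + z) - x ^ 2 - (y - z) ^ 2) := h ▸ by positivity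
    exact pos_of_mul_pos_right this hr.le
  have hle : 2 * x * (y + z) - x ^ 2 - (y - z) ^ 2 ≤ 3 * (y * z) := by
    have := mul_le_mul_of_nonneg_right hxr hQ.le
    refine le_of_mul_le_mul_left ?_ hx
    linarith
  have hsq : y * z ≤ (y + z - x) ^ 2 := by linarith
  have hy' : y + z - x ≤ y := by linarith
  have hz' : y + z - x ≤ z := by linarith
  have hpos : 0 < y + z - x := by linarith
  have h₁ : x = z := by nlinarith
  have h₂ : x = y := by nlinarith
  exact ⟨h₂, h₂ ▸ h₁⟩

theorem stmt11 (O A B C : EuclideanSpace ℝ (Fin 2)) (R : ℝ) (hR : 0 < R)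
    (hAB : A ≠ B) (hBC : B ≠ C) (hAC : A ≠ C)
    (hA : dist O A = R) (hB : dist O B = R) (hC : dist O C = R)
    (hacuteA : ∠ B A C < π / 2) (hacuteB : ∠ A B C < π / 2) (hacuteC : ∠ A C B < π / 2) :
    Real.sqrt 3 * R ≤ max (dist A B) (max (dist B C) (dist C A)) ∧
      (max (dist A B) (max (dist B C) (dist C A)) = Real.sqrt 3 * R ↔
        (dist A B = dist B C ∧ dist B C = dist C A)) := by
  have key := sq_dist_mul_eq_sq_circumradius_mul O A B C R hA hB hC
  have acA := sq_dist_lt_of_angle_lt_pi_div_two hAB.symm hAC.symm hacuteA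
  have acB := sq_dist_lt_of_angle_lt_pi_div_two hAB hBC.symm hacuteB
  have acC := sq_dist_lt_of_angle_lt_pi_div_two hAC hBC hacuteC
  have pAB := dist_pos.2 hAB
  have pBC := dist_pos.2 hBC
  have pCA := dist_pos.2 hAC.symm
  rw [dist_comm B A] at acA
  rw [dist_comm A C, dist_comm C B] at acB
  rw [dist_comm A C] at acC
  generalize dist A B = u at *
  generalize dist B C = v at *
  generalize dist C A = w at *
  have hR2 : (√3 * R) ^ 2 = 3 * R ^ 2 := by
    rw [mul_pow, Real.sq_sqrt (by norm_num)]
  have h3R : 0 < √3 * R := by positivity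
  have equilateral_of_le (h : max u (max v w) ≤ √3 * R) : u = v ∧ v = w := by
    have sq_inj {s t : ℝ} (hs : 0 < s) (ht : 0 < t) (hst : s ^ 2 = t ^ 2) : s = t :=
      (pow_left_inj₀ hs.le ht.le two_ne_zero).1 hst
    have side_eq {a b c : ℝ} (ha : 0 < a) (hb : 0 < b) (hc : 0 < c) (hba : b ≤ a) (hca : c ≤ a)
        (hac : a ^ 2 < b ^ 2 + c ^ 2) (hle : a ≤ √3 * R)
        (hk : a ^ 2 * b ^ 2 * c ^ 2 = R ^ 2 *
          (2 * a ^ 2 * (b ^ 2 + c ^ 2) - (a ^ 2) ^ 2 - (b ^ 2 - c ^ 2) ^ 2)) :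
        a = b ∧ b = c := by
      obtain ⟨h₁, h₂⟩ := eq_and_eq_of_le_three_mul (by positivity) (by positivity) (by positivity)
        (by positivity) (pow_le_pow_left₀ hb.le hba 2) (pow_le_pow_left₀ hc.le hca 2) hac hk
        (hR2 ▸ pow_le_pow_left₀ ha.le hle 2)
      exact ⟨sq_inj ha hb h₁, sq_inj hb hc h₂⟩
    simp only [max_le_iff] at h
    obtain ⟨hu, hv, hw⟩ := h
    have of_v_max (huv : u ≤ v) (hwv : w ≤ v) : u = v ∧ v = w := by
      obtain ⟨h₁, h₂⟩ := side_eq pBC pCA pAB hwv huv (by linarith) hv (by linarith)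
      exact ⟨by linarith, h₁⟩
    have of_w_max (huw : u ≤ w) (hvw : v ≤ w) : u = v ∧ v = w := by
      obtain ⟨h₁, h₂⟩ := side_eq pCA pAB pBC huw hvw (by linarith) hw (by linarith)
      exact ⟨h₂, by linarith⟩
    rcases le_total u v with huv | hvu
    · rcases le_total v w with hvw | hwv
      · exact of_w_max (huv.trans hvw) hvw
      · exact of_v_max huv hwv
    · rcases le_total u w with huw | hwu
      · exact of_w_max huw (hvu.trans huw)
      · exact side_eq pAB pBC pCA hvu hwu (by linarith) hu key
  have max_eq (h : u = v ∧ v = w) : max u (max v w) = √3 * R := by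
    obtain ⟨rfl, rfl⟩ := h
    rw [max_self, max_self]
    refine (pow_left_inj₀ pAB.le h3R.le two_ne_zero).1 ?_
    rw [hR2]
    have : (u ^ 2) ^ 2 ≠ 0 := by positivity
    refine mul_left_cancel₀ this ?_
    linarith
  refine ⟨?_, fun h => equilateral_of_le h.le, max_eq⟩
  by_contra! h
  exact h.ne (max_eq (equilateral_of_le h.le))
end

section
/- For a regular tetrahedron with unit edge, the extrinsic diameter and radius are diam(T) = 1 and rad(T) = √(2/3). -/
open scoped ENNReal

/-- The intrinsic (geodesic) distance on a subset `T` of `ℝ³`: the infimum of the lengths of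
continuous paths from `x` to `y` staying in `T`. -/
noncomputable def rho (T : Set (EuclideanSpace ℝ (Fin 3)))
    (x y : EuclideanSpace ℝ (Fin 3)) : ℝ≥0∞ :=
  ⨅ (γ : ℝ → EuclideanSpace ℝ (Fin 3)) (_ : Continuous γ) (_ : γ 0 = x) (_ : γ 1 = y)
    (_ : ∀ t ∈ Set.Icc (0 : ℝ) 1, γ t ∈ T), eVariationOn γ (Set.Icc 0 1)

/-- Intrinsic diameter. -/
noncomputable def intrinsicDiam (T : Set (EuclideanSpace ℝ (Fin 3))) : ℝ≥0∞ :=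
  ⨆ x ∈ T, ⨆ y ∈ T, rho T x y

/-- Intrinsic radius. -/
noncomputable def intrinsicRad (T : Set (EuclideanSpace ℝ (Fin 3))) : ℝ≥0∞ :=
  ⨅ x ∈ T, ⨆ y ∈ T, rho T x y

/-- Extrinsic radius. -/
noncomputable def extrinsicRad (T : Set (EuclideanSpace ℝ (Fin 3))) : ℝ≥0∞ :=
  ⨅ x ∈ T, ⨆ y ∈ T, edist x y

theorem sq_dist_affineCombination_of_pairwise_dist_eq_one {ι V P : Type*} [Fintype ι]
    [NormedAddCommGroup V] [InnerProductSpace ℝ V] [MetricSpace P] [NormedAddTorsor V P]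
    {p : ι → P} (hp : Pairwise fun i j => dist (p i) (p j) = 1) {w₁ w₂ : ι → ℝ}
    (h₁ : ∑ i, w₁ i = 1) (h₂ : ∑ i, w₂ i = 1) :
    dist (Finset.univ.affineCombination ℝ p w₁) (Finset.univ.affineCombination ℝ p w₂) ^ 2 =
      (∑ i, (w₁ i - w₂ i) ^ 2) / 2 := by
  classical
  have hd : ∀ i j, dist (p i) (p j) * dist (p i) (p j) = 1 - if i = j then (1 : ℝ) else 0 := by
    intro i j
    by_cases h : i = j
    · simp [h]
    · simp [h, hp h]
  rw [sq, EuclideanGeometry.dist_affineCombination p h₁ h₂]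
  simp [hd, mul_sub, ← Finset.mul_sum, h₁, h₂, sq]

theorem affineIndependent_of_pairwise_dist_eq_one {ι V P : Type*} [Fintype ι]
    [NormedAddCommGroup V] [InnerProductSpace ℝ V] [MetricSpace P] [NormedAddTorsor V P]
    {p : ι → P} (hp : Pairwise fun i j => dist (p i) (p j) = 1) : AffineIndependent ℝ p := by
  rw [affineIndependent_iff_eq_of_fintype_affineCombination_eq]
  intro w₁ w₂ h₁ h₂ h
  have hs := sq_dist_affineCombination_of_pairwise_dist_eq_one hp h₁ h₂
  rw [h, dist_self] at hs
  have hs' : ∑ i, (w₁ i - w₂ i) ^ 2 = 0 := by linarith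
  rw [Finset.sum_eq_zero_iff_of_nonneg fun i _ => sq_nonneg _] at hs'
  ext i
  have := hs' i (Finset.mem_univ i)
  exact sub_eq_zero.1 (pow_eq_zero_iff two_ne_zero |>.1 this)

theorem AffineBasis.sq_dist_of_pairwise_dist_eq_one {ι V : Type*} [Fintype ι]
    [NormedAddCommGroup V] [InnerProductSpace ℝ V] (B : AffineBasis ι ℝ V)
    (hB : Pairwise fun i j => dist (B i) (B j) = 1) (x y : V) :
    dist x y ^ 2 = (∑ i, (B.coord i x - B.coord i y) ^ 2) / 2 := by
  rw [← sq_dist_affineCombination_of_pairwise_dist_eq_one hB (B.sum_coord_apply_eq_one x)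
    (B.sum_coord_apply_eq_one y), B.affineCombination_coord_eq_self,
    B.affineCombination_coord_eq_self]

theorem AffineBasis.mem_frontier_convexHull_iff {ι V : Type*} [Finite ι]
    [NormedAddCommGroup V] [NormedSpace ℝ V] (B : AffineBasis ι ℝ V) (x : V) :
    x ∈ frontier (convexHull ℝ (Set.range B)) ↔
      (∀ i, 0 ≤ B.coord i x) ∧ ∃ i, B.coord i x = 0 := by
  rw [((Set.finite_range B).isClosed_convexHull ℝ).frontier_eq, B.interior_convexHull,
    B.convexHull_eq_nonneg_coord]
  constructor
  · rintro ⟨h, h'⟩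
    obtain ⟨i, hi⟩ := not_forall.1 h'
    exact ⟨h, i, le_antisymm (not_lt.1 hi) (h i)⟩
  · rintro ⟨h, i, hi⟩
    exact ⟨h, fun h' => (h' i).ne' hi⟩

theorem stmt12 (a b c d : EuclideanSpace ℝ (Fin 3))
    (h1 : dist a b = 1) (h2 : dist a c = 1) (h3 : dist a d = 1)
    (h4 : dist b c = 1) (h5 : dist b d = 1) (h6 : dist c d = 1)
    (T : Set (EuclideanSpace ℝ (Fin 3)))
    (hT : T = frontier (convexHull ℝ ({a, b, c, d} : Set (EuclideanSpace ℝ (Fin 3))))) :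
    EMetric.diam T = 1 ∧ extrinsicRad T = ENNReal.ofReal (Real.sqrt (2 / 3)) := by
  have hp : Pairwise fun i j => dist (![a, b, c, d] i) (![a, b, c, d] j) = 1 := by
    intro i j hij
    fin_cases i <;> fin_cases j <;> simp_all [dist_comm]
  have hind := affineIndependent_of_pairwise_dist_eq_one hp
  let B : AffineBasis (Fin 4) ℝ (EuclideanSpace ℝ (Fin 3)) :=
    ⟨![a, b, c, d], hind, hind.affineSpan_eq_top_iff_card_eq_finrank_add_one.2 (by simp)⟩
  have hrange : Set.range B = {a, b, c, d} := by
    change Set.range ![a, b, c, d] = _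
    simp only [Matrix.range_cons, Matrix.range_empty, Set.union_empty, Set.insert_eq]
  have hB : Pairwise fun i j => dist (B i) (B j) = 1 := hp
  have hmem : ∀ x, x ∈ T ↔ (∀ i, 0 ≤ B.coord i x) ∧ ∃ i, B.coord i x = 0 := fun x => by
    rw [hT, ← hrange, B.mem_frontier_convexHull_iff]
  have hdist := B.sq_dist_of_pairwise_dist_eq_one hB
  have hsum := B.sum_coord_apply_eq_one
  have hvert : ∀ i, B i ∈ T := fun i => by
    obtain ⟨j, hj⟩ := exists_ne i
    refine (hmem _).2 ⟨fun k => ?_, j, B.coord_apply_ne hj⟩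
    rw [B.coord_apply]
    split_ifs <;> norm_num
  refine ⟨le_antisymm (Metric.ediam_le fun x hx y hy => ?_) ?_, le_antisymm ?_ ?_⟩
  · have hd := hdist x y
    have hx' := ((hmem x).1 hx).1
    have hy' := ((hmem y).1 hy).1
    have hxs := hsum x
    have hys := hsum y
    have hxle := fun i => (Finset.single_le_sum (fun j _ => hx' j) (Finset.mem_univ i)).trans_eq hxs
    have hyle := fun i => (Finset.single_le_sum (fun j _ => hy' j) (Finset.mem_univ i)).trans_eq hys
    have hle : ∑ i, (B.coord i x - B.coord i y) ^ 2 ≤ ∑ i, (B.coord i x + B.coord i y) :=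
      Finset.sum_le_sum fun i _ => by
        nlinarith [hx' i, hy' i, hxle i, hyle i, mul_nonneg (hx' i) (hy' i)]
    rw [Finset.sum_add_distrib] at hle
    rw [edist_dist, ENNReal.ofReal_le_one, ← abs_of_nonneg (dist_nonneg (x := x) (y := y)),
      ← sq_le_one_iff_abs_le_one]
    linarith
  · have h : edist (B 0) (B 1) = 1 := by
      rw [edist_dist, hB (by decide), ENNReal.ofReal_one]
    exact h ▸ Metric.edist_le_ediam_of_mem (hvert 0) (hvert 1)
  · let w : Fin 4 → ℝ := ![0, 1 / 3, 1 / 3, 1 / 3]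
    have hw : ∑ i, w i = 1 := by simp [w, Fin.sum_univ_four]; norm_num
    let x := Finset.univ.affineCombination ℝ B w
    have hx : ∀ i, B.coord i x = w i := fun i =>
      B.coord_apply_combination_of_mem (Finset.mem_univ i) hw
    have hxT : x ∈ T := by
      refine (hmem x).2 ⟨fun i => ?_, 0, hx 0⟩
      rw [hx]
      fin_cases i <;> norm_num [w]
    refine iInf₂_le_of_le x hxT (iSup₂_le fun y hy => ?_)
    rw [edist_dist]
    refine ENNReal.ofReal_le_ofReal (Real.le_sqrt_of_sq_le ?_)
    have hy' := ((hmem y).1 hy).1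
    have hys := hsum y
    rw [hdist]
    simp only [hx, Fin.sum_univ_four] at hys ⊢
    simp only [w, Matrix.cons_val]
    nlinarith [mul_nonneg (hy' 0) (hy' 1), mul_nonneg (hy' 0) (hy' 2), mul_nonneg (hy' 0) (hy' 3),
      mul_nonneg (hy' 1) (hy' 2), mul_nonneg (hy' 1) (hy' 3), mul_nonneg (hy' 2) (hy' 3),
      hy' 0, hy' 1, hy' 2, hy' 3]
  · refine le_iInf₂ fun x hx => ?_
    obtain ⟨-, i, hi⟩ := (hmem x).1 hx
    refine le_iSup₂_of_le (B i) (hvert i) ?_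
    rw [edist_dist]
    refine ENNReal.ofReal_le_ofReal (Real.sqrt_le_iff.2 ⟨dist_nonneg, ?_⟩)
    have hxs := hsum x
    rw [hdist]
    simp only [B.coord_apply]
    rw [← Finset.add_sum_erase _ _ (Finset.mem_univ i)] at hxs ⊢
    have hcs := sq_sum_le_card_mul_sum_sq (s := Finset.univ.erase i) (f := fun j => B.coord j x)
    have hcongr : ∑ j ∈ Finset.univ.erase i, (B.coord j x - if j = i then 1 else 0) ^ 2 =
        ∑ j ∈ Finset.univ.erase i, B.coord j x ^ 2 :=
      Finset.sum_congr rfl fun j hj => by simp [Finset.ne_of_mem_erase hj]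
    rw [hi, zero_add] at hxs
    rw [hxs] at hcs
    rw [hcongr, hi]
    norm_num at hcs ⊢
    linarith
end

section
/- For a regular tetrahedron with unit edge, the intrinsic radius is Rad(T) = 1; moreover it is realized between midpoints of opposite edges: with m = midpoint ℝ a b and q = midpoint ℝ c d, one has ⨆_{y ∈ T} ρ(m, y) = 1 and ρ(m, q) = 1. -/
open scoped ENNReal

/-! ### Paths along finitely many closed pieces -/

/-- If functions `f i` are `1`-Lipschitz on closed sets `A i` and agree on overlaps, then they
jointly are `1`-Lipschitz with respect to the length of paths covered by the `A i`. -/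
lemma edist_le_eVariationOn_of_closed_cover {E F ι : Type*} [PseudoEMetricSpace E]
    [PseudoEMetricSpace F] {A : ι → Set E} {f : ι → E → F}
    (hA : ∀ i, IsClosed (A i)) (hf : ∀ i, LipschitzOnWith 1 (f i) (A i))
    (hcompat : ∀ i j z, z ∈ A i → z ∈ A j → f i z = f j z)
    {γ : ℝ → E} (hγ : Continuous γ) {t : ℝ} (S : Finset ι) :
    ∀ s ≤ t, (∀ r ∈ Set.Icc s t, ∃ i ∈ S, γ r ∈ A i) →
      ∀ i j, γ s ∈ A i → γ t ∈ A j → edist (f i (γ s)) (f j (γ t)) ≤ eVariationOn γ (Set.Icc s t) := by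
  classical
  induction S using Finset.strongInduction with
  | H S ih =>
    intro s hst hS i j hi hj
    obtain ⟨k, hkS, hk⟩ := hS s ⟨le_rfl, hst⟩
    have hcomp : IsCompact (Set.Icc s t ∩ γ ⁻¹' A k) :=
      isCompact_Icc.inter_right ((hA k).preimage hγ)
    obtain ⟨u, ⟨hu, huk⟩, humax⟩ := hcomp.exists_isGreatest ⟨s, ⟨le_rfl, hst⟩, hk⟩
    have hfirst : edist (f i (γ s)) (f k (γ u)) ≤ eVariationOn γ (Set.Icc s u) := by
      rw [hcompat i k _ hi hk]
      refine (hf k hk huk).trans ?_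
      simpa using eVariationOn.edist_le γ (s := Set.Icc s u) ⟨le_rfl, hu.1⟩ ⟨hu.1, le_rfl⟩
    have hadd : eVariationOn γ (Set.Icc s u) + eVariationOn γ (Set.Icc u t)
        = eVariationOn γ (Set.Icc s t) := by
      simpa using eVariationOn.Icc_add_Icc γ (s := Set.univ) hu.1 hu.2 (Set.mem_univ u)
    rcases hu.2.eq_or_lt with rfl | hut
    · rwa [hcompat j k _ hj huk]
    have hrest : ∀ r ∈ Set.Ioc u t, ∃ l ∈ S.erase k, γ r ∈ A l := by
      intro r hr
      obtain ⟨l, hl, hrl⟩ := hS r ⟨hu.1.trans hr.1.le, hr.2⟩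
      refine ⟨l, Finset.mem_erase.2 ⟨?_, hl⟩, hrl⟩
      rintro rfl
      exact absurd (humax ⟨⟨hu.1.trans hr.1.le, hr.2⟩, hrl⟩) (not_le.2 hr.1)
    have hclosed : IsClosed (γ ⁻¹' ⋃ l ∈ S.erase k, A l) :=
      ((S.erase k).finite_toSet.isClosed_biUnion fun l _ => hA l).preimage hγ
    have hsub : Set.Icc u t ⊆ γ ⁻¹' ⋃ l ∈ S.erase k, A l := by
      rw [← closure_Ioc hut.ne]
      refine closure_minimal (fun r hr => ?_) hclosed
      simpa using hrest r hr
    refine (edist_triangle _ (f k (γ u)) _).trans (hadd ▸ add_le_add hfirst ?_)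
    refine ih _ (Finset.erase_ssubset hkS) u hu.2 (fun r hr => ?_) k j huk hj
    simpa using hsub hr

/-- A `1`-Lipschitz path parametrized by the unit interval bounds the intrinsic distance by `1`. -/
lemma rho_le_one_of_lipschitz {T : Set (EuclideanSpace ℝ (Fin 3))}
    {γ : ℝ → EuclideanSpace ℝ (Fin 3)} (hγ : LipschitzWith 1 γ)
    (hT : ∀ t ∈ Set.Icc (0 : ℝ) 1, γ t ∈ T) : rho T (γ 0) (γ 1) ≤ 1 := by
  unfold rho
  refine iInf_le_of_le γ <| iInf_le_of_le hγ.continuous <| iInf_le_of_le rfl <|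
    iInf_le_of_le rfl <| iInf_le_of_le hT ?_
  have h := (hγ.lipschitzOnWith (s := Set.univ)).comp_eVariationOn_le (g := (id : ℝ → ℝ))
    (s := Set.Icc 0 1) (Set.mapsTo_univ _ _)
  have h2 := (monotone_id.monotoneOn (Set.univ : Set ℝ)).eVariationOn_eq
    (Set.mem_univ (0 : ℝ)) (Set.mem_univ (1 : ℝ))
  simp only [Set.univ_inter, id_eq, sub_zero, ENNReal.ofReal_one] at h2
  simpa [h2] using h

/-! ### The triangular lattice in the plane -/

/-- The point with coordinates `s, t` in the basis `1, exp (π i / 3)` of the plane. -/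
noncomputable def eis (s t : ℝ) : ℂ := ⟨s + t / 2, √3 / 2 * t⟩

lemma eis_add (s t s' t' : ℝ) : eis s t + eis s' t' = eis (s + s') (t + t') := by
  apply Complex.ext <;> simp [eis] <;> ring

lemma eis_neg (s t : ℝ) : -eis s t = eis (-s) (-t) := by
  apply Complex.ext <;> simp [eis]; ring

lemma eis_sub (s t s' t' : ℝ) : eis s t - eis s' t' = eis (s - s') (t - t') := by
  rw [sub_eq_add_neg, eis_neg, eis_add]; rfl

lemma norm_eis_sq (s t : ℝ) : ‖eis s t‖ ^ 2 = s ^ 2 + s * t + t ^ 2 := by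
  rw [← Complex.normSq_eq_norm_sq, Complex.normSq_apply]
  have := Real.mul_self_sqrt (show (0 : ℝ) ≤ 3 by norm_num)
  simp only [eis]
  linear_combination t ^ 2 / 4 * this

lemma exists_eis (z : ℂ) : ∃ s t, z = eis s t := by
  have h3 : √3 ≠ 0 := by positivity
  refine ⟨z.re - z.im / √3, 2 * z.im / √3, Complex.ext ?_ ?_⟩ <;> simp only [eis] <;> field_simp
  ring

lemma one_le_norm_eis_int {m n : ℤ} (h : m ≠ 0 ∨ n ≠ 0) : 1 ≤ ‖eis m n‖ := by
  have h1 : (1 : ℤ) ≤ m ^ 2 + m * n + n ^ 2 := by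
    have : 0 < m ^ 2 + m * n + n ^ 2 := by
      rcases h with h | h
      · nlinarith [sq_nonneg (m + 2 * n), pow_pos (abs_pos.2 h) 2, sq_abs m]
      · nlinarith [sq_nonneg (2 * m + n), pow_pos (abs_pos.2 h) 2, sq_abs n]
    omega
  have h2 : (1 : ℝ) ≤ m ^ 2 + m * n + n ^ 2 := by exact_mod_cast h1
  rw [← norm_eis_sq] at h2
  exact (one_le_sq_iff₀ (norm_nonneg _)).1 h2

/-- The points of the doubled triangular lattice. -/
noncomputable def evenEis (k : ℤ × ℤ) : ℂ := eis (2 * k.1) (2 * k.2)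

lemma evenEis_add (k l : ℤ × ℤ) : evenEis k + evenEis l = evenEis (k + l) := by
  simp only [evenEis, eis_add, Prod.fst_add, Prod.snd_add]; push_cast; congr 1 <;> ring

lemma evenEis_neg (k : ℤ × ℤ) : -evenEis k = evenEis (-k) := by
  simp only [evenEis, eis_neg, Prod.fst_neg, Prod.snd_neg]; push_cast; congr 1 <;> ring

lemma evenEis_sub (k l : ℤ × ℤ) : evenEis k - evenEis l = evenEis (k - l) := by
  rw [sub_eq_add_neg, evenEis_neg, evenEis_add]; rfl

lemma evenEis_zero : evenEis 0 = 0 := by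
  apply Complex.ext <;> simp [evenEis, eis]

lemma two_le_norm_evenEis {k : ℤ × ℤ} (h : k ≠ 0) : 2 ≤ ‖evenEis k‖ := by
  have h1 : k.1 ≠ 0 ∨ k.2 ≠ 0 := by
    by_contra! h'
    exact h (Prod.ext h'.1 h'.2)
  have h2 : evenEis k = 2 * eis k.1 k.2 := by
    apply Complex.ext <;> simp [evenEis, eis] <;> ring
  rw [h2, norm_mul]
  have := one_le_norm_eis_int h1
  norm_num
  linarith

/-- The orbit of a point under the half-turns about the points of the triangular lattice
and the translations they generate. -/
def halfTurnOrbit (x : ℂ) : Set ℂ := {p | ∃ k, p = x + evenEis k ∨ p = -x + evenEis k}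

lemma self_mem_halfTurnOrbit (x : ℂ) : x ∈ halfTurnOrbit x :=
  ⟨0, Or.inl (by rw [evenEis_zero, add_zero])⟩

lemma infDist_halfTurnOrbit_sub (x p : ℂ) (k : ℤ × ℤ) :
    Metric.infDist (evenEis k - p) (halfTurnOrbit x) = Metric.infDist p (halfTurnOrbit x) := by
  have key : ∀ p, Metric.infDist (evenEis k - p) (halfTurnOrbit x) ≤
      Metric.infDist p (halfTurnOrbit x) := by
    intro p
    refine (Metric.le_infDist ⟨x, self_mem_halfTurnOrbit x⟩).2 ?_
    rintro y ⟨l, hy⟩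
    have hmem : evenEis k - y ∈ halfTurnOrbit x := by
      refine ⟨k - l, ?_⟩
      rw [← evenEis_sub]
      rcases hy with rfl | rfl
      · exact Or.inr (by ring)
      · exact Or.inl (by ring)
    simpa [dist_eq_norm, norm_sub_rev] using
      Metric.infDist_le_dist_of_mem (x := evenEis k - p) hmem
  refine le_antisymm (key p) ?_
  simpa using key (evenEis k - p)

lemma infDist_halfTurnOrbit_add (x p : ℂ) (k : ℤ × ℤ) :
    Metric.infDist (p + evenEis k) (halfTurnOrbit x) = Metric.infDist p (halfTurnOrbit x) := by
  rw [← infDist_halfTurnOrbit_sub x p 0, ← infDist_halfTurnOrbit_sub x (evenEis 0 - p) k,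
    evenEis_zero]
  congr 1
  ring

/-- Two translates of the packing by open unit disks centred at the doubled triangular lattice
never cover the plane. -/
lemma exists_one_le_infDist_halfTurnOrbit (x : ℂ) :
    ∃ p, 1 ≤ Metric.infDist p (halfTurnOrbit x) := by
  by_contra! hcon
  have hcover : ∀ p ∈ Metric.sphere x 1, ∃ k, p ∈ Metric.ball (-x + evenEis k) 1 := by
    intro p hp
    obtain ⟨y, ⟨k, hy⟩, hd⟩ := (Metric.infDist_lt_iff ⟨x, self_mem_halfTurnOrbit x⟩).1 (hcon p)
    rcases hy with rfl | rfl
    · exfalso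
      by_cases hk : k = 0
      · rw [hk, evenEis_zero, add_zero, Metric.mem_sphere.1 hp] at hd
        exact lt_irrefl _ hd
      · have h1 := two_le_norm_evenEis hk
        have h2 := dist_triangle_left x (x + evenEis k) p
        rw [Metric.mem_sphere.1 hp, dist_self_add_right] at h2
        linarith
    · exact ⟨k, hd⟩
  have hx1 : x + 1 ∈ Metric.sphere x 1 := by simp
  obtain ⟨k, hk⟩ := hcover _ hx1
  have hpre : IsPreconnected (Metric.sphere x 1) :=
    isPreconnected_sphere (by rw [Complex.rank_real_complex]; norm_num) x 1
  have hsub : Metric.sphere x 1 ⊆ Metric.ball (-x + evenEis k) 1 := by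
    refine (isPreconnected_iff_subset_of_disjoint.1 hpre _
      (⋃ l ∈ {l | l ≠ k}, Metric.ball (-x + evenEis l) 1) Metric.isOpen_ball
      (isOpen_biUnion fun _ _ => Metric.isOpen_ball) ?_ ?_).resolve_right ?_
    · intro p hp
      obtain ⟨l, hl⟩ := hcover p hp
      by_cases hlk : l = k
      · exact Or.inl (hlk ▸ hl)
      · exact Or.inr (Set.mem_biUnion (show l ∈ {l | l ≠ k} from hlk) hl)
    all_goals
      have hdisj : ∀ p ∈ Metric.ball (-x + evenEis k) 1,
          p ∉ ⋃ l ∈ {l | l ≠ k}, Metric.ball (-x + evenEis l) 1 := by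
        intro p hp hp'
        obtain ⟨l, hl, hpl⟩ := Set.mem_iUnion₂.1 hp'
        have h1 := two_le_norm_evenEis (sub_ne_zero.2 hl)
        have h2 := dist_triangle_left (-x + evenEis l) (-x + evenEis k) p
        rw [dist_add_left, dist_eq_norm, evenEis_sub] at h2
        rw [Metric.mem_ball] at hp hpl
        linarith
    · exact Set.eq_empty_of_forall_notMem fun p hp => hdisj p hp.2.1 hp.2.2
    · exact fun h => hdisj _ hk (h hx1)
  have h1 := Metric.mem_ball.1 (hsub (show x - 1 ∈ Metric.sphere x 1 by simp))
  have h2 := dist_triangle_right (x + 1) (x - 1) (-x + evenEis k)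
  have h3 : dist (x + 1) (x - 1) = 2 := by
    rw [dist_eq_norm]; ring_nf; simp
  rw [Metric.mem_ball] at hk
  linarith

/-! ### Barycentric coordinates on the regular tetrahedron -/

section Tetrahedron

lemma dist_affineCombination_sq {p : Fin 4 → EuclideanSpace ℝ (Fin 3)}
    (hp : ∀ i j, i ≠ j → dist (p i) (p j) = 1) {w w' : Fin 4 → ℝ}
    (hw : ∑ i, w i = 1) (hw' : ∑ i, w' i = 1) :
    dist (Finset.univ.affineCombination ℝ p w) (Finset.univ.affineCombination ℝ p w') ^ 2
      = (∑ i, (w i - w' i) ^ 2) / 2 := by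
  have h := EuclideanGeometry.dist_affineCombination p hw hw'
  simp only at h
  rw [sq, h]
  simp only [Fin.sum_univ_four, dist_self, Pi.sub_apply,
    hp 0 1 (by decide), hp 0 2 (by decide), hp 0 3 (by decide),
    hp 1 0 (by decide), hp 1 2 (by decide), hp 1 3 (by decide),
    hp 2 0 (by decide), hp 2 1 (by decide), hp 2 3 (by decide),
    hp 3 0 (by decide), hp 3 1 (by decide), hp 3 2 (by decide)]
  rw [Fin.sum_univ_four] at hw hw'
  linear_combination (-1 / 2) * (w 0 + w 1 + w 2 + w 3 - (w' 0 + w' 1 + w' 2 + w' 3)) * (hw - hw')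

lemma affineIndependent_of_dist_eq_one {p : Fin 4 → EuclideanSpace ℝ (Fin 3)}
    (hp : ∀ i j, i ≠ j → dist (p i) (p j) = 1) : AffineIndependent ℝ p := by
  rw [affineIndependent_iff_of_fintype]
  intro w hw h0
  have h := EuclideanGeometry.inner_weightedVSub p hw p hw
  rw [h0, inner_zero_left] at h
  simp only [Fin.sum_univ_four, dist_self,
    hp 0 1 (by decide), hp 0 2 (by decide), hp 0 3 (by decide),
    hp 1 0 (by decide), hp 1 2 (by decide), hp 1 3 (by decide),
    hp 2 0 (by decide), hp 2 1 (by decide), hp 2 3 (by decide),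
    hp 3 0 (by decide), hp 3 1 (by decide), hp 3 2 (by decide)] at h
  rw [Fin.sum_univ_four] at hw
  have h2 : ∑ i, w i ^ 2 = 0 := by
    rw [Fin.sum_univ_four]
    linear_combination (-2) * h + (w 0 + w 1 + w 2 + w 3) * hw
  intro i
  have := (Finset.sum_eq_zero_iff_of_nonneg fun i _ => sq_nonneg (w i)).1 h2 i (Finset.mem_univ i)
  exact pow_eq_zero_iff two_ne_zero |>.1 this

/-- The surface of a tetrahedron in barycentric coordinates. -/
def tetSurface (B : AffineBasis (Fin 4) ℝ (EuclideanSpace ℝ (Fin 3))) :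
    Set (EuclideanSpace ℝ (Fin 3)) :=
  {z | (∀ i, 0 ≤ B.coord i z) ∧ ∃ i, B.coord i z = 0}

/-- The face of a tetrahedron opposite to the vertex `i`. -/
def tetFace (B : AffineBasis (Fin 4) ℝ (EuclideanSpace ℝ (Fin 3))) (i : Fin 4) :
    Set (EuclideanSpace ℝ (Fin 3)) :=
  {z | (∀ j, 0 ≤ B.coord j z) ∧ B.coord i z = 0}

lemma mem_tetSurface {B : AffineBasis (Fin 4) ℝ (EuclideanSpace ℝ (Fin 3))}
    {z : EuclideanSpace ℝ (Fin 3)} : z ∈ tetSurface B ↔ ∃ i, z ∈ tetFace B i :=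
  exists_and_left.symm

lemma frontier_convexHull_range (B : AffineBasis (Fin 4) ℝ (EuclideanSpace ℝ (Fin 3))) :
    frontier (convexHull ℝ (Set.range B)) = tetSurface B := by
  have hclosed : IsClosed (convexHull ℝ (Set.range B)) :=
    (Set.finite_range B).isClosed_convexHull ℝ
  rw [hclosed.frontier_eq, B.interior_convexHull, B.convexHull_eq_nonneg_coord]
  ext z
  simp only [tetSurface, Set.mem_sdiff, Set.mem_ofPred_eq]
  refine and_congr_right fun h => ?_
  push Not
  exact exists_congr fun i => ⟨fun hi => le_antisymm hi (h i), le_of_eq⟩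

lemma tetSurface_reindex (B : AffineBasis (Fin 4) ℝ (EuclideanSpace ℝ (Fin 3)))
    (e : Fin 4 ≃ Fin 4) : tetSurface (B.reindex e) = tetSurface B := by
  rw [← frontier_convexHull_range, ← frontier_convexHull_range, B.coe_reindex,
    e.symm.surjective.range_comp]

lemma isClosed_tetFace (B : AffineBasis (Fin 4) ℝ (EuclideanSpace ℝ (Fin 3))) (i : Fin 4) :
    IsClosed (tetFace B i) := by
  have hc : ∀ j, Continuous (B.coord j) := fun j =>
    AffineMap.continuous_of_finiteDimensional (B.coord j)
  have h : tetFace B i = (⋂ j, {z | 0 ≤ B.coord j z}) ∩ {z | B.coord i z = 0} := by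
    ext z; simp [tetFace]
  rw [h]
  exact (isClosed_iInter fun j => isClosed_le continuous_const (hc j)).inter
    (isClosed_eq (hc i) continuous_const)

variable {B : AffineBasis (Fin 4) ℝ (EuclideanSpace ℝ (Fin 3))}

lemma dist_sq_eq_coord (hB : ∀ i j, i ≠ j → dist (B i) (B j) = 1)
    (z w : EuclideanSpace ℝ (Fin 3)) :
    dist z w ^ 2 = (∑ i, (B.coord i z - B.coord i w) ^ 2) / 2 := by
  have h := dist_affineCombination_sq hB (B.sum_coord_apply_eq_one z) (B.sum_coord_apply_eq_one w)
  rwa [B.affineCombination_coord_eq_self, B.affineCombination_coord_eq_self] at h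

/-- The unfolding into the plane of the face opposite to the vertex `i`. -/
noncomputable def unfoldFace (B : AffineBasis (Fin 4) ℝ (EuclideanSpace ℝ (Fin 3))) (i : Fin 4)
    (z : EuclideanSpace ℝ (Fin 3)) : ℂ :=
  eis
    (![B.coord 1 z + B.coord 3 z, -B.coord 3 z, B.coord 1 z + B.coord 3 z, B.coord 1 z] i)
    (![B.coord 2 z + B.coord 3 z, B.coord 2 z + B.coord 3 z, -B.coord 3 z, B.coord 2 z] i)

lemma dist_unfoldFace (hB : ∀ i j, i ≠ j → dist (B i) (B j) = 1) {i : Fin 4}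
    {z w : EuclideanSpace ℝ (Fin 3)} (hz : z ∈ tetFace B i) (hw : w ∈ tetFace B i) :
    dist (unfoldFace B i z) (unfoldFace B i w) = dist z w := by
  have h := dist_sq_eq_coord hB z w
  have hz1 := B.sum_coord_apply_eq_one z
  have hw1 := B.sum_coord_apply_eq_one w
  rw [Fin.sum_univ_four] at h hz1 hw1
  have hz0 := hz.2
  have hw0 := hw.2
  rw [← sq_eq_sq₀ dist_nonneg dist_nonneg, h, dist_eq_norm, unfoldFace, unfoldFace, eis_sub,
    norm_eis_sq]
  have e0 : B.coord 0 z = 1 - B.coord 1 z - B.coord 2 z - B.coord 3 z := by linarith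
  have e1 : B.coord 0 w = 1 - B.coord 1 w - B.coord 2 w - B.coord 3 w := by linarith
  fin_cases i <;> simp at hz0 hw0 ⊢
  · have e2 : B.coord 3 z = 1 - B.coord 1 z - B.coord 2 z := by linarith
    have e3 : B.coord 3 w = 1 - B.coord 1 w - B.coord 2 w := by linarith
    rw [e0, e1, e2, e3]; ring
  all_goals rw [e0, e1, hz0, hw0]; ring

lemma infDist_unfoldFace_congr (x : ℂ) {i j : Fin 4} {z : EuclideanSpace ℝ (Fin 3)}
    (hi : z ∈ tetFace B i) (hj : z ∈ tetFace B j) :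
    Metric.infDist (unfoldFace B i z) (halfTurnOrbit x) =
      Metric.infDist (unfoldFace B j z) (halfTurnOrbit x) := by
  wlog hij : i ≤ j generalizing i j
  · exact (this hj hi (le_of_not_ge hij)).symm
  have hz1 := B.sum_coord_apply_eq_one z
  rw [Fin.sum_univ_four] at hz1
  have hi0 := hi.2
  have hj0 := hj.2
  have key : ∀ m n : ℤ, unfoldFace B i z = evenEis (m, n) - unfoldFace B j z →
      Metric.infDist (unfoldFace B i z) (halfTurnOrbit x) =
        Metric.infDist (unfoldFace B j z) (halfTurnOrbit x) := fun m n h => by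
    rw [h, infDist_halfTurnOrbit_sub]
  rcases hij.eq_or_lt with rfl | hij
  · rfl
  fin_cases i <;> fin_cases j <;> simp at hij hi0 hj0 key ⊢
  · apply key 0 1
    simp only [unfoldFace, evenEis, eis_sub]
    congr 1 <;> simp <;> linarith
  · apply key 1 0
    simp only [unfoldFace, evenEis, eis_sub]
    congr 1 <;> simp <;> linarith
  · simp [unfoldFace, hj0]
  · apply key 0 0
    simp only [unfoldFace, evenEis, eis_sub]
    congr 1 <;> simp <;> linarith
  · simp [unfoldFace, hi0, hj0]
  · simp [unfoldFace, hi0, hj0]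

/-- The intrinsic distance on the tetrahedron is at least the distance of the unfolded points
modulo half-turns. -/
lemma infDist_unfoldFace_le_rho (hB : ∀ i j, i ≠ j → dist (B i) (B j) = 1) {i j : Fin 4}
    {x y : EuclideanSpace ℝ (Fin 3)} (hx : x ∈ tetFace B i) (hy : y ∈ tetFace B j) :
    ENNReal.ofReal (Metric.infDist (unfoldFace B j y) (halfTurnOrbit (unfoldFace B i x)))
      ≤ rho (tetSurface B) x y := by
  unfold rho
  refine le_iInf fun γ => le_iInf fun hγ => le_iInf fun h0 => le_iInf fun h1 => le_iInf fun hT => ?_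
  subst h0 h1
  have h := edist_le_eVariationOn_of_closed_cover (A := tetFace B)
    (f := fun k z => Metric.infDist (unfoldFace B k z) (halfTurnOrbit (unfoldFace B i (γ 0))))
    (isClosed_tetFace B) (fun k => ?_) (fun k l z hk hl => infDist_unfoldFace_congr _ hk hl) hγ
    Finset.univ 0 zero_le_one
    (fun r hr => by simpa using mem_tetSurface.1 (hT r hr)) i j hx hy
  · refine le_trans (le_of_eq ?_) h
    rw [Metric.infDist_zero_of_mem (self_mem_halfTurnOrbit _), edist_dist, dist_zero_left,
      Real.norm_of_nonneg Metric.infDist_nonneg]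
  · refine LipschitzOnWith.of_dist_le_mul fun z hz w hw => ?_
    have := (Metric.lipschitz_infDist_pt (halfTurnOrbit (unfoldFace B i (γ 0)))).dist_le_mul
      (unfoldFace B k z) (unfoldFace B k w)
    rwa [dist_unfoldFace hB hz hw] at this

lemma exists_coord_eq (B : AffineBasis (Fin 4) ℝ (EuclideanSpace ℝ (Fin 3))) {w : Fin 4 → ℝ}
    (hw : ∑ i, w i = 1) : ∃ z, ∀ i, B.coord i z = w i :=
  ⟨_, fun i => B.coord_apply_combination_of_mem (Finset.mem_univ i) hw⟩

/-- The unfolded faces contain a fundamental domain for the half-turns. -/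
lemma exists_infDist_unfoldFace_eq (B : AffineBasis (Fin 4) ℝ (EuclideanSpace ℝ (Fin 3)))
    (x p : ℂ) : ∃ i, ∃ y ∈ tetFace B i,
      Metric.infDist (unfoldFace B i y) (halfTurnOrbit x) = Metric.infDist p (halfTurnOrbit x) := by
  have hpos : ∀ s t : ℝ, s ≤ 1 → t ≤ 1 → -1 ≤ t → -s ≤ t → (0 ≤ s ∨ 0 ≤ t) →
      ∃ i, ∃ y ∈ tetFace B i, unfoldFace B i y = eis s t := by
    intro s t hs1 ht1 ht2 hst h
    by_cases hs : 0 ≤ s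
    · by_cases ht : 0 ≤ t
      · by_cases hsum : s + t ≤ 1
        · obtain ⟨y, hy⟩ := exists_coord_eq B (w := ![1 - s - t, s, t, 0])
            (by simp [Fin.sum_univ_four]; ring)
          refine ⟨3, y, ⟨fun j => ?_, by simp [hy]⟩, by simp [unfoldFace, hy]⟩
          fin_cases j <;> simp [hy] <;> linarith
        · obtain ⟨y, hy⟩ := exists_coord_eq B (w := ![0, 1 - t, 1 - s, s + t - 1])
            (by simp [Fin.sum_univ_four]; ring)
          refine ⟨0, y, ⟨fun j => ?_, by simp [hy]⟩, by simp [unfoldFace, hy]⟩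
          fin_cases j <;> simp [hy] <;> linarith
      · obtain ⟨y, hy⟩ := exists_coord_eq B (w := ![1 - s, s + t, 0, -t])
            (by simp [Fin.sum_univ_four]; ring)
        refine ⟨2, y, ⟨fun j => ?_, by simp [hy]⟩, by simp [unfoldFace, hy]⟩
        fin_cases j <;> simp [hy] <;> linarith
    · obtain ⟨y, hy⟩ := exists_coord_eq B (w := ![1 - t, 0, s + t, -s])
            (by simp [Fin.sum_univ_four])
      refine ⟨1, y, ⟨fun j => ?_, by simp [hy]⟩, by simp [unfoldFace, hy]⟩
      fin_cases j <;> simp [hy] <;> linarith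
  obtain ⟨s, t, rfl⟩ := exists_eis p
  have hround : ∀ r : ℝ, ∃ m : ℤ, -1 ≤ r - 2 * m ∧ r - 2 * m ≤ 1 := fun r => by
    have := abs_le.1 (abs_sub_round (r / 2))
    exact ⟨round (r / 2), by linarith, by linarith⟩
  obtain ⟨m, hm1, hm2⟩ := hround s
  obtain ⟨n, hn1, hn2⟩ := hround t
  by_cases hst : -(s - 2 * m) ≤ t - 2 * n
  · obtain ⟨i, y, hy, h⟩ := hpos (s - 2 * m) (t - 2 * n) hm2 hn2 hn1 hst (by
      by_contra! h; linarith)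
    refine ⟨i, y, hy, ?_⟩
    rw [h, ← infDist_halfTurnOrbit_add _ _ (m, n), evenEis, eis_add]
    simp
  · obtain ⟨i, y, hy, h⟩ := hpos (2 * m - s) (2 * n - t) (by linarith) (by linarith)
      (by linarith) (by linarith) (by by_contra! h; linarith)
    refine ⟨i, y, hy, ?_⟩
    rw [h, ← infDist_halfTurnOrbit_sub _ (eis s t) (m, n), evenEis, eis_sub]

lemma exists_one_le_rho (hB : ∀ i j, i ≠ j → dist (B i) (B j) = 1)
    {x : EuclideanSpace ℝ (Fin 3)} (hx : x ∈ tetSurface B) :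
    ∃ y ∈ tetSurface B, 1 ≤ rho (tetSurface B) x y := by
  obtain ⟨i, hi⟩ := mem_tetSurface.1 hx
  obtain ⟨p, hp⟩ := exists_one_le_infDist_halfTurnOrbit (unfoldFace B i x)
  obtain ⟨j, y, hy, h⟩ := exists_infDist_unfoldFace_eq B (unfoldFace B i x) p
  refine ⟨y, mem_tetSurface.2 ⟨j, hy⟩, le_trans ?_ (infDist_unfoldFace_le_rho hB hi hy)⟩
  rwa [h, ENNReal.one_le_ofReal]

/-! ### The midpoint of an edge -/

lemma coord_midpoint (i j k : Fin 4) :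
    B.coord k (midpoint ℝ (B i) (B j)) =
      ((if k = i then 1 else 0) + (if k = j then 1 else 0)) / 2 := by
  rw [AffineMap.map_midpoint, B.coord_apply, B.coord_apply, midpoint_eq_smul_add]
  simp; ring

lemma one_le_rho_midpoint (hB : ∀ i j, i ≠ j → dist (B i) (B j) = 1) :
    1 ≤ rho (tetSurface B) (midpoint ℝ (B 0) (B 1)) (midpoint ℝ (B 2) (B 3)) := by
  have hm : midpoint ℝ (B 0) (B 1) ∈ tetFace B 3 := by
    refine ⟨fun k => ?_, ?_⟩ <;> rw [coord_midpoint]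
    · positivity
    · simp
  have hq : midpoint ℝ (B 2) (B 3) ∈ tetFace B 0 := by
    refine ⟨fun k => ?_, ?_⟩ <;> rw [coord_midpoint]
    · positivity
    · simp
  refine le_trans ?_ (infDist_unfoldFace_le_rho hB hm hq)
  rw [ENNReal.one_le_ofReal, Metric.le_infDist ⟨_, self_mem_halfTurnOrbit _⟩]
  have h1 : unfoldFace B 3 (midpoint ℝ (B 0) (B 1)) = eis (1 / 2) 0 := by
    simp only [unfoldFace, coord_midpoint]
    congr 1 <;> simp
  have h2 : unfoldFace B 0 (midpoint ℝ (B 2) (B 3)) = eis (1 / 2) 1 := by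
    simp only [unfoldFace, coord_midpoint]
    congr 1 <;> simp
    norm_num
  rw [h1, h2]
  rintro _ ⟨⟨k, l⟩, rfl | rfl⟩
  · have h : dist (eis (1 / 2) 1) (eis (1 / 2) 0 + evenEis (k, l)) =
        ‖eis ((-2 * k : ℤ) : ℝ) ((1 - 2 * l : ℤ) : ℝ)‖ := by
      rw [dist_eq_norm, evenEis, eis_add, eis_sub]; push_cast; congr 2 <;> ring
    rw [h]
    exact one_le_norm_eis_int (Or.inr (by omega))
  · have h : dist (eis (1 / 2) 1) (-eis (1 / 2) 0 + evenEis (k, l)) =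
        ‖eis ((1 - 2 * k : ℤ) : ℝ) ((1 - 2 * l : ℤ) : ℝ)‖ := by
      rw [dist_eq_norm, evenEis, eis_neg, eis_add, eis_sub]; push_cast; congr 2 <;> ring
    rw [h]
    exact one_le_norm_eis_int (Or.inr (by omega))

/-- A path given by barycentric weights bounds the intrinsic distance by `1`. -/
lemma rho_le_one_of_weights (hB : ∀ i j, i ≠ j → dist (B i) (B j) = 1) {w : ℝ → Fin 4 → ℝ}
    (hsum : ∀ t, ∑ i, w t i = 1)
    (hlip : ∀ s t, s ≤ t → (∑ i, (w s i - w t i) ^ 2) / 2 ≤ (t - s) ^ 2)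
    (hnonneg : ∀ t ∈ Set.Icc (0 : ℝ) 1, ∀ i, 0 ≤ w t i)
    (hzero : ∀ t ∈ Set.Icc (0 : ℝ) 1, ∃ i, w t i = 0) {x y : EuclideanSpace ℝ (Fin 3)}
    (hx : ∀ i, B.coord i x = w 0 i) (hy : ∀ i, B.coord i y = w 1 i) :
    rho (tetSurface B) x y ≤ 1 := by
  have hcoord : ∀ t i, B.coord i (Finset.univ.affineCombination ℝ B (w t)) = w t i := fun t i =>
    B.coord_apply_combination_of_mem (Finset.mem_univ i) (hsum t)
  have hx' : Finset.univ.affineCombination ℝ B (w 0) = x := by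
    rw [← B.affineCombination_coord_eq_self x]; congr 1; ext i; exact (hx i).symm
  have hy' : Finset.univ.affineCombination ℝ B (w 1) = y := by
    rw [← B.affineCombination_coord_eq_self y]; congr 1; ext i; exact (hy i).symm
  rw [← hx', ← hy']
  refine rho_le_one_of_lipschitz (γ := fun t => Finset.univ.affineCombination ℝ B (w t))
    (LipschitzWith.of_dist_le_mul fun s t => ?_) fun t ht => ⟨fun i => ?_, ?_⟩
  · rw [NNReal.coe_one, one_mul]
    wlog hst : s ≤ t generalizing s t
    · rw [dist_comm, dist_comm s]
      exact this t s (le_of_not_ge hst)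
    refine le_of_sq_le_sq ?_ dist_nonneg
    rw [dist_affineCombination_sq hB (hsum s) (hsum t), dist_comm, Real.dist_eq, sq_abs]
    exact hlip s t hst
  · rw [hcoord]; exact hnonneg t ht i
  · simpa only [hcoord] using hzero t ht

lemma rho_midpoint_le_one_of_mem_face_three (hB : ∀ i j, i ≠ j → dist (B i) (B j) = 1)
    {y : EuclideanSpace ℝ (Fin 3)} (hy : y ∈ tetFace B 3) :
    rho (tetSurface B) (midpoint ℝ (B 0) (B 1)) y ≤ 1 := by
  have h1 := B.sum_coord_apply_eq_one y
  have h0 := hy.1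
  have h3 := hy.2
  rw [Fin.sum_univ_four, h3] at h1
  have hc0 : B.coord 0 y = 1 - B.coord 1 y - B.coord 2 y := by linarith
  have hn0 := h0 0
  have hn1 := h0 1
  have hn2 := h0 2
  generalize hβ : B.coord 1 y = β at *
  generalize hγ : B.coord 2 y = γ at *
  refine rho_le_one_of_weights hB
    (w := fun t => ![(1 - t) / 2 + t * (1 - β - γ), (1 - t) / 2 + t * β, t * γ, 0])
    ?_ ?_ ?_ ?_ ?_ ?_
  · intro t; simp [Fin.sum_univ_four]; ring
  · intro s t hst
    simp [Fin.sum_univ_four]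
    have : (1 / 2 - β - γ) ^ 2 + (β - 1 / 2) ^ 2 + γ ^ 2 ≤ 2 := by nlinarith
    nlinarith [mul_le_mul_of_nonneg_left this (sq_nonneg (t - s))]
  · rintro t ⟨ht0, ht1⟩ i
    have : 0 ≤ 1 - β - γ := by linarith
    have ht : 0 ≤ 1 - t := by linarith
    fin_cases i <;> simp <;> positivity
  · intro t _; exact ⟨3, rfl⟩
  · intro i; rw [coord_midpoint]; fin_cases i <;> simp
  · intro i; fin_cases i <;> simp [hc0, h3] <;> assumption

/-- Unfold the face `0 2 3` about the edge `0 2` and fold the straight segment back. -/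
lemma rho_midpoint_le_one_of_mem_face_one_of_le (hB : ∀ i j, i ≠ j → dist (B i) (B j) = 1)
    {y : EuclideanSpace ℝ (Fin 3)} (hy : y ∈ tetFace B 1) (hle : B.coord 3 y ≤ B.coord 2 y) :
    rho (tetSurface B) (midpoint ℝ (B 0) (B 1)) y ≤ 1 := by
  have hsum := B.sum_coord_apply_eq_one y
  have h0 := hy.1
  have h1 := hy.2
  rw [Fin.sum_univ_four, h1] at hsum
  have hc0 : B.coord 0 y = 1 - B.coord 2 y - B.coord 3 y := by linarith
  have hn0 := h0 0
  have hn2 := h0 2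
  have hn3 := h0 3
  generalize hγ : B.coord 2 y = γ at *
  generalize hδ : B.coord 3 y = δ at *
  rw [hc0] at hn0
  refine rho_le_one_of_weights hB
    (w := fun t => ![(1 - t) + t * (1 - γ - δ) - max ((1 - t) / 2 - t * δ) 0,
      max ((1 - t) / 2 - t * δ) 0,
      (1 - t) / 2 + t * γ - max ((1 - t) / 2 - t * δ) 0,
      t * δ - (1 - t) / 2 + max ((1 - t) / 2 - t * δ) 0])
    ?_ ?_ ?_ ?_ ?_ ?_
  · intro t; simp [Fin.sum_univ_four]; ring
  · intro s t hst
    simp only [Fin.sum_univ_four, Matrix.cons_val]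
    have hbound : ((γ + δ) ^ 2 + (1 / 2 - γ) ^ 2 + (1 / 2 + δ) ^ 2) / 2 ≤ 1 := by nlinarith
    have hscaled := mul_le_mul_of_nonneg_left hbound (sq_nonneg (t - s))
    rcases le_total ((1 - s) / 2 - s * δ) 0 with hs | hs <;>
      rcases le_total ((1 - t) / 2 - t * δ) 0 with ht | ht
    · rw [max_eq_right hs, max_eq_right ht]; linarith
    · have hs' : 0 ≤ (1 - s) / 2 - s * δ := by
        linarith [mul_le_mul_of_nonneg_right hst hn3]
      rw [max_eq_left hs', max_eq_left ht]; linarith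
    · rw [max_eq_left hs, max_eq_right ht]
      nlinarith [mul_nonneg hs (sub_nonneg.2 ht)]
    · rw [max_eq_left hs, max_eq_left ht]; linarith
  · rintro t ⟨ht0, ht1⟩ i
    have ht : 0 ≤ 1 - t := by linarith
    have m1 := mul_nonneg ht0 hn0
    have m2 := mul_nonneg ht0 hn2
    have m3 := mul_nonneg ht0 hn3
    rcases le_total ((1 - t) / 2 - t * δ) 0 with h | h
    · fin_cases i <;> simp [max_eq_right h] <;> linarith
    · fin_cases i <;> simp [max_eq_left h] <;> linarith
  · intro t _
    rcases le_total ((1 - t) / 2 - t * δ) 0 with h | h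
    · exact ⟨1, by simp [h]⟩
    · exact ⟨3, by simp [max_eq_left h]⟩
  · intro i; rw [coord_midpoint]; fin_cases i <;> simp
    norm_num
  · have hmax : max (-δ) 0 = 0 := max_eq_right (by linarith)
    intro i; fin_cases i <;> simp [hc0, h1, hγ, hδ, hmax]

lemma dist_reindex_eq_one (hB : ∀ i j, i ≠ j → dist (B i) (B j) = 1) (e : Fin 4 ≃ Fin 4)
    (i j : Fin 4) (hij : i ≠ j) : dist (B.reindex e i) (B.reindex e j) = 1 := by
  rw [B.reindex_apply, B.reindex_apply]
  exact hB _ _ (e.symm.injective.ne hij)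

lemma tetFace_reindex (e : Fin 4 ≃ Fin 4) (i : Fin 4) :
    tetFace (B.reindex e) i = tetFace B (e.symm i) := by
  ext z
  simp only [tetFace, B.coord_reindex, Set.mem_ofPred_eq]
  exact and_congr_left fun _ => e.symm.forall_congr_right (q := fun j => 0 ≤ B.coord j z)

lemma rho_midpoint_le_one_of_mem_face_one (hB : ∀ i j, i ≠ j → dist (B i) (B j) = 1)
    {y : EuclideanSpace ℝ (Fin 3)} (hy : y ∈ tetFace B 1) :
    rho (tetSurface B) (midpoint ℝ (B 0) (B 1)) y ≤ 1 := by
  rcases le_total (B.coord 3 y) (B.coord 2 y) with h | h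
  · exact rho_midpoint_le_one_of_mem_face_one_of_le hB hy h
  · rw [← tetSurface_reindex B (Equiv.swap 2 3)]
    refine rho_midpoint_le_one_of_mem_face_one_of_le (B := B.reindex (Equiv.swap 2 3))
      (dist_reindex_eq_one hB _) ?_ ?_
    · rw [tetFace_reindex]; exact hy
    · rw [B.coord_reindex, B.coord_reindex]; exact h

lemma rho_midpoint_le_one (hB : ∀ i j, i ≠ j → dist (B i) (B j) = 1)
    {y : EuclideanSpace ℝ (Fin 3)} (hy : y ∈ tetSurface B) :
    rho (tetSurface B) (midpoint ℝ (B 0) (B 1)) y ≤ 1 := by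
  obtain ⟨i, hi⟩ := mem_tetSurface.1 hy
  fin_cases i
  · rw [← tetSurface_reindex B (Equiv.swap 0 1), midpoint_comm]
    refine rho_midpoint_le_one_of_mem_face_one (B := B.reindex (Equiv.swap 0 1))
      (dist_reindex_eq_one hB _) ?_
    rw [tetFace_reindex]; exact hi
  · exact rho_midpoint_le_one_of_mem_face_one hB hi
  · rw [← tetSurface_reindex B (Equiv.swap 2 3)]
    refine rho_midpoint_le_one_of_mem_face_three (B := B.reindex (Equiv.swap 2 3))
      (dist_reindex_eq_one hB _) ?_
    rw [tetFace_reindex]; exact hi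
  · exact rho_midpoint_le_one_of_mem_face_three hB hi

lemma midpoint_mem_tetSurface {i j k : Fin 4} (hi : k ≠ i) (hj : k ≠ j) :
    midpoint ℝ (B i) (B j) ∈ tetSurface B := by
  refine ⟨fun l => ?_, k, ?_⟩ <;> rw [coord_midpoint]
  · positivity
  · simp [hi, hj]

end Tetrahedron

theorem stmt14 (a b c d : EuclideanSpace ℝ (Fin 3))
    (h1 : dist a b = 1) (h2 : dist a c = 1) (h3 : dist a d = 1)
    (h4 : dist b c = 1) (h5 : dist b d = 1) (h6 : dist c d = 1)
    (T : Set (EuclideanSpace ℝ (Fin 3)))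
    (hT : T = frontier (convexHull ℝ ({a, b, c, d} : Set (EuclideanSpace ℝ (Fin 3))))) :
    intrinsicRad T = 1 ∧
      (⨆ y ∈ T, rho T (midpoint ℝ a b) y) = 1 ∧
      rho T (midpoint ℝ a b) (midpoint ℝ c d) = 1 := by
  have hp : ∀ i j, i ≠ j → dist (![a, b, c, d] i) (![a, b, c, d] j) = 1 := by
    intro i j hij
    fin_cases i <;> fin_cases j <;> simp_all [dist_comm]
  have hind := affineIndependent_of_dist_eq_one hp
  let B : AffineBasis (Fin 4) ℝ (EuclideanSpace ℝ (Fin 3)) :=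
    ⟨![a, b, c, d], hind, hind.affineSpan_eq_top_iff_card_eq_finrank_add_one.2 (by simp)⟩
  have hB : ∀ i j, i ≠ j → dist (B i) (B j) = 1 := hp
  have hrange : Set.range B = {a, b, c, d} := by
    change Set.range ![a, b, c, d] = _
    ext y
    simp [eq_comm]
    tauto
  rw [← hrange, frontier_convexHull_range] at hT
  subst hT
  change _ ∧ (⨆ y ∈ tetSurface B, rho _ (midpoint ℝ (B 0) (B 1)) y) = 1 ∧
    rho _ (midpoint ℝ (B 0) (B 1)) (midpoint ℝ (B 2) (B 3)) = 1
  have hm : midpoint ℝ (B 0) (B 1) ∈ tetSurface B :=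
    midpoint_mem_tetSurface (k := 2) (by decide) (by decide)
  have hq : midpoint ℝ (B 2) (B 3) ∈ tetSurface B :=
    midpoint_mem_tetSurface (k := 0) (by decide) (by decide)
  have hsup : (⨆ y ∈ tetSurface B, rho (tetSurface B) (midpoint ℝ (B 0) (B 1)) y) = 1 :=
    le_antisymm (iSup₂_le fun y hy => rho_midpoint_le_one hB hy)
      ((one_le_rho_midpoint hB).trans (le_iSup₂_of_le _ hq le_rfl))
  refine ⟨le_antisymm ?_ ?_, hsup,
    le_antisymm (rho_midpoint_le_one hB hq) (one_le_rho_midpoint hB)⟩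
  · exact iInf₂_le_of_le _ hm hsup.le
  · refine le_iInf₂ fun x hx => ?_
    obtain ⟨y, hy, h⟩ := exists_one_le_rho hB hx
    exact le_iSup₂_of_le y hy h
end

section
/- There exists ε₀ > 0 such that every ε₀-thick tetrahedron satisfies diam(T) = dist a b and diam(T) = 2 · rad(T). -/
open scoped ENNReal

theorem lineMap_mem_frontier_convexHull {a b c d : EuclideanSpace ℝ (Fin 3)}
    (h : AffineIndependent ℝ ![a, b, c, d]) {t : ℝ} (ht : t ∈ Set.Icc (0 : ℝ) 1) :
    AffineMap.lineMap a b t ∈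
      frontier (convexHull ℝ ({a, b, c, d} : Set (EuclideanSpace ℝ (Fin 3)))) := by
  have hrange : Set.range ![a, b, c, d] = {a, b, c, d} := by
    simp only [Matrix.range_cons, Matrix.range_empty, Set.union_empty, Set.singleton_union]
  have htop : affineSpan ℝ (Set.range ![a, b, c, d]) = ⊤ := by
    rw [h.affineSpan_eq_top_iff_card_eq_finrank_add_one]
    simp
  let B : AffineBasis (Fin 4) ℝ (EuclideanSpace ℝ (Fin 3)) := ⟨![a, b, c, d], h, htop⟩
  have hint : interior (convexHull ℝ {a, b, c, d}) = {x | ∀ i, 0 < B.coord i x} := by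
    rw [← B.interior_convexHull, ← hrange]
    rfl
  refine ⟨subset_closure ?_, fun hmem => ?_⟩
  · exact (convex_convexHull ℝ _).lineMap_mem (subset_convexHull ℝ _ (by simp))
      (subset_convexHull ℝ _ (by simp)) ht
  · rw [hint] at hmem
    have ha : B.coord 2 a = 0 := B.coord_apply_ne (i := 2) (j := 0) (by decide)
    have hb : B.coord 2 b = 0 := B.coord_apply_ne (i := 2) (j := 1) (by decide)
    have hpos := hmem 2
    rw [AffineMap.apply_lineMap, ha, hb] at hpos
    simp at hpos

theorem stmt15 :
    ∃ ε₀ : ℝ, 0 < ε₀ ∧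
      ∀ a b c d : EuclideanSpace ℝ (Fin 3),
        AffineIndependent ℝ ![a, b, c, d] →
        c ∈ Metric.closedBall (midpoint ℝ a b) (ε₀ * dist a b) →
        d ∈ Metric.closedBall (midpoint ℝ a b) (ε₀ * dist a b) →
        ∀ T : Set (EuclideanSpace ℝ (Fin 3)),
          T = frontier (convexHull ℝ ({a, b, c, d} : Set (EuclideanSpace ℝ (Fin 3)))) →
          EMetric.diam T = edist a b ∧ EMetric.diam T = 2 * extrinsicRad T := by
  refine ⟨1 / 2, by norm_num, ?_⟩
  rintro a b c d h hc hd T rfl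
  set T := frontier (convexHull ℝ ({a, b, c, d} : Set (EuclideanSpace ℝ (Fin 3))))
  have haT : a ∈ T := by
    simpa using lineMap_mem_frontier_convexHull h (t := 0) (by simp)
  have hbT : b ∈ T := by
    simpa using lineMap_mem_frontier_convexHull h (t := 1) (by simp)
  have hmT : midpoint ℝ a b ∈ T :=
    lineMap_mem_frontier_convexHull h (t := ⅟2) (by norm_num)
  have hball : T ⊆ Metric.closedBall (midpoint ℝ a b) (1 / 2 * dist a b) := by
    refine frontier_subset_closure.trans (closure_minimal ?_ Metric.isClosed_closedBall)
    refine convexHull_min ?_ (convex_closedBall _ _)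
    rintro x (rfl | rfl | rfl | rfl)
    · simp [dist_left_midpoint]
    · simp [dist_right_midpoint]
    · exact hc
    · exact hd
  have hrad : ∀ y ∈ T, edist (midpoint ℝ a b) y ≤ edist a b / 2 := fun y hy => by
    have hy' := Metric.mem_closedBall'.1 (hball hy)
    have hhalf : ENNReal.ofReal (dist a b / 2) = edist a b / 2 := by
      rw [ENNReal.ofReal_div_of_pos two_pos, edist_dist, ENNReal.ofReal_ofNat]
    rw [edist_dist, ← hhalf]
    exact ENNReal.ofReal_le_ofReal (by linarith)
  have hdiam : Metric.ediam T = edist a b := by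
    refine le_antisymm (Metric.ediam_le fun x hx y hy => ?_)
      (Metric.edist_le_ediam_of_mem haT hbT)
    calc edist x y ≤ edist (midpoint ℝ a b) x + edist (midpoint ℝ a b) y :=
          edist_triangle_left _ _ _
      _ ≤ edist a b / 2 + edist a b / 2 := add_le_add (hrad x hx) (hrad y hy)
      _ = edist a b := ENNReal.add_halves _
  have hlow : edist a b / 2 ≤ extrinsicRad T := by
    refine le_iInf₂ fun x _ => ENNReal.div_le_of_le_mul ?_
    calc edist a b ≤ edist x a + edist x b := edist_triangle_left _ _ _
      _ ≤ (⨆ y ∈ T, edist x y) + ⨆ y ∈ T, edist x y :=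
          add_le_add (le_iSup₂ (f := fun y (_ : y ∈ T) => edist x y) a haT)
            (le_iSup₂ (f := fun y (_ : y ∈ T) => edist x y) b hbT)
      _ = (⨆ y ∈ T, edist x y) * 2 := (mul_two _).symm
  have hrad_eq : extrinsicRad T = edist a b / 2 :=
    le_antisymm (iInf₂_le_of_le _ hmT (iSup₂_le hrad)) hlow
  refine ⟨hdiam, hdiam.trans ?_⟩
  rw [hrad_eq, ENNReal.mul_div_cancel two_ne_zero ENNReal.ofNat_ne_top]
end

section
/- There exists ε₀ > 0 such that every normal ε₀-thick tetrahedron satisfies Rad(T) = (dist a b)/2 and Diam(T) = 2 · Rad(T). -/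
open scoped ENNReal

open scoped RealInnerProductSpace

open AffineMap in
theorem rho_le_edist_of_segment_subset {T : Set (EuclideanSpace ℝ (Fin 3))}
    {x y : EuclideanSpace ℝ (Fin 3)} (h : segment ℝ x y ⊆ T) : rho T x y ≤ edist x y := by
  refine iInf_le_of_le (lineMap x y) <| iInf_le_of_le lineMap_continuous <|
    iInf_le_of_le (lineMap_apply_zero x y) <| iInf_le_of_le (lineMap_apply_one x y) <|
    iInf_le_of_le (fun t ht => h ?_) ?_
  · rw [segment_eq_image_lineMap]
    exact ⟨t, ht, rfl⟩
  · have hL : LipschitzOnWith (nndist x y) (lineMap x y : ℝ → EuclideanSpace ℝ (Fin 3))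
        (Set.Icc 0 1) := (lipschitzWith_lineMap x y).lipschitzOnWith
    have hv := hL.comp_eVariationOn_le (g := (id : ℝ → ℝ)) (s := Set.Icc 0 1)
      (Set.mapsTo_id _)
    have hid : eVariationOn (id : ℝ → ℝ) (Set.Icc 0 1) = 1 := by simp
    calc eVariationOn (lineMap x y : ℝ → EuclideanSpace ℝ (Fin 3)) (Set.Icc 0 1)
        ≤ nndist x y * eVariationOn (id : ℝ → ℝ) (Set.Icc 0 1) := hv
      _ = edist x y := by rw [hid, mul_one, edist_nndist]

theorem edist_le_rho (T : Set (EuclideanSpace ℝ (Fin 3))) (x y : EuclideanSpace ℝ (Fin 3)) :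
    edist x y ≤ rho T x y := by
  refine le_iInf fun γ => le_iInf fun _ => le_iInf fun h0 => le_iInf fun h1 => le_iInf fun _ => ?_
  rw [← h0, ← h1]
  exact eVariationOn.edist_le γ (by simp) (by simp)

theorem rho_le_rho_swap (T : Set (EuclideanSpace ℝ (Fin 3))) (x y : EuclideanSpace ℝ (Fin 3)) :
    rho T x y ≤ rho T y x := by
  refine le_iInf fun γ => le_iInf fun hc => le_iInf fun h0 => le_iInf fun h1 => le_iInf fun hT => ?_
  refine iInf_le_of_le (γ ∘ fun t => 1 - t) <| iInf_le_of_le (by fun_prop) <|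
    iInf_le_of_le (by simpa using h1) <| iInf_le_of_le (by simpa using h0) <|
    iInf_le_of_le (fun t ht => hT _ ⟨by linarith [ht.2], by linarith [ht.1]⟩) ?_
  exact eVariationOn.comp_le_of_antitoneOn γ _ (fun s _ t _ hst => sub_le_sub_left hst 1)
    (fun t ht => ⟨by linarith [ht.2], by linarith [ht.1]⟩)

theorem rho_comm (T : Set (EuclideanSpace ℝ (Fin 3))) (x y : EuclideanSpace ℝ (Fin 3)) :
    rho T x y = rho T y x :=
  (rho_le_rho_swap T x y).antisymm (rho_le_rho_swap T y x)

theorem rho_triangle (T : Set (EuclideanSpace ℝ (Fin 3))) (x y z : EuclideanSpace ℝ (Fin 3)) :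
    rho T x z ≤ rho T x y + rho T y z := by
  unfold rho
  simp only [ENNReal.iInf_add, ENNReal.add_iInf]
  refine le_iInf fun γ' => le_iInf fun hc' => le_iInf fun h0' => le_iInf fun h1' =>
    le_iInf fun hT' => le_iInf fun γ => le_iInf fun hc => le_iInf fun h0 => le_iInf fun h1 =>
    le_iInf fun hT => ?_
  set Γ : ℝ → EuclideanSpace ℝ (Fin 3) :=
    fun t => if t ≤ 1 / 2 then γ (2 * t) else γ' (2 * t - 1) with hΓ
  have hΓl : Set.EqOn Γ (γ ∘ fun t => 2 * t) (Set.Icc 0 (1 / 2)) := fun t ht => if_pos ht.2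
  have hΓr : Set.EqOn Γ (γ' ∘ fun t => 2 * t - 1) (Set.Icc (1 / 2) 1) := fun t ht => by
    rcases ht.1.eq_or_lt with h | h
    · simp [hΓ, ← h, h1, h0']
    · exact if_neg (not_le.2 h)
  refine iInf_le_of_le Γ <| iInf_le_of_le ?_ <| iInf_le_of_le (by simp [hΓ, h0]) <|
    iInf_le_of_le (by norm_num [hΓ, h1']) <| iInf_le_of_le (fun t ht => ?_) ?_
  · refine Continuous.if_le (by fun_prop) (by fun_prop) continuous_id continuous_const ?_
    rintro t rfl
    norm_num [h1, h0']
  · by_cases h : t ≤ 1 / 2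
    · rw [show Γ t = γ (2 * t) from if_pos h]
      exact hT _ ⟨by linarith [ht.1], by linarith⟩
    · rw [show Γ t = γ' (2 * t - 1) from if_neg h]
      exact hT' _ ⟨by linarith, by linarith [ht.2]⟩
  · have hsplit := eVariationOn.Icc_add_Icc Γ (s := Set.univ) (a := (0 : ℝ)) (b := 1 / 2) (c := 1)
      (by norm_num) (by norm_num) (Set.mem_univ _)
    simp only [Set.univ_inter] at hsplit
    rw [← hsplit, eVariationOn.congr hΓl, eVariationOn.congr hΓr]
    gcongr
    · exact eVariationOn.comp_le_of_monotoneOn γ _ (fun s _ t _ hst => by simpa using hst)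
        (fun t ht => ⟨by linarith [ht.1], by linarith [ht.2]⟩)
    · exact eVariationOn.comp_le_of_monotoneOn γ' _ (fun s _ t _ hst => by simpa using hst)
        (fun t ht => ⟨by linarith [ht.1], by linarith [ht.2]⟩)

theorem smul_add_smul_add_smul_mem_convexHull {E : Type*} [AddCommGroup E] [Module ℝ E]
    (x y z : E) {r s t : ℝ} (hr : 0 ≤ r) (hs : 0 ≤ s) (ht : 0 ≤ t) (h : r + s + t = 1) :
    r • x + s • y + t • z ∈ convexHull ℝ {x, y, z} := by
  have := (convex_convexHull ℝ {x, y, z}).sum_mem (t := Finset.univ) (w := ![r, s, t])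
    (z := ![x, y, z]) (by intro i _; fin_cases i <;> simpa) (by simpa [Fin.sum_univ_three] using h)
    (by intro i _; fin_cases i <;> exact subset_convexHull _ _ (by simp))
  simpa [Fin.sum_univ_three] using this

/-- The surface of a tetrahedron is the union of its four faces. -/
theorem frontier_convexHull_tetrahedron {a b c d : EuclideanSpace ℝ (Fin 3)}
    (hI : AffineIndependent ℝ ![a, b, c, d]) :
    frontier (convexHull ℝ {a, b, c, d}) =
      convexHull ℝ {b, c, d} ∪ convexHull ℝ {a, c, d} ∪
        (convexHull ℝ {a, b, d} ∪ convexHull ℝ {a, b, c}) := by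
  let B : AffineBasis (Fin 4) ℝ (EuclideanSpace ℝ (Fin 3)) :=
    ⟨![a, b, c, d], hI, hI.affineSpan_eq_top_iff_card_eq_finrank_add_one.2 (by simp)⟩
  have hBp : ∀ i, B i = ![a, b, c, d] i := fun _ => rfl
  have hr : ({a, b, c, d} : Set (EuclideanSpace ℝ (Fin 3))) = Set.range B := by
    have : (B : Fin 4 → EuclideanSpace ℝ (Fin 3)) = ![a, b, c, d] := rfl
    rw [this]
    simp only [Matrix.range_cons, Matrix.range_empty, Set.union_empty, Set.singleton_union]
  have hcl : IsClosed (convexHull ℝ ({a, b, c, d} : Set (EuclideanSpace ℝ (Fin 3)))) :=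
    (Set.toFinite _).isClosed_convexHull ℝ
  have hmem : ∀ x, x ∈ frontier (convexHull ℝ ({a, b, c, d} : Set (EuclideanSpace ℝ (Fin 3)))) ↔
      x ∈ convexHull ℝ ({a, b, c, d} : Set (EuclideanSpace ℝ (Fin 3))) ∧
        ∃ i, B.coord i x ≤ 0 := by
    intro x
    rw [hcl.frontier_eq, hr, B.interior_convexHull]
    simp
  have hface : ∀ (i : Fin 4) (s : Set (EuclideanSpace ℝ (Fin 3))), s ⊆ {a, b, c, d} →
      (∀ p ∈ s, B.coord i p = 0) →
      convexHull ℝ s ⊆ frontier (convexHull ℝ ({a, b, c, d} : Set (EuclideanSpace ℝ (Fin 3)))) := by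
    intro i s hs h0 x hx
    refine (hmem x).2 ⟨convexHull_mono hs hx, i, ?_⟩
    have hconv : Convex ℝ (B.coord i ⁻¹' {0}) := (convex_singleton (0 : ℝ)).affine_preimage _
    exact (convexHull_min (fun p hp => h0 p hp) hconv hx).le
  have hcoord : ∀ i j, i ≠ j → B.coord i (![a, b, c, d] j) = 0 := fun i j h =>
    hBp j ▸ B.coord_apply_ne h
  have h01 := hcoord 0 1 (by decide)
  have h02 := hcoord 0 2 (by decide)
  have h03 := hcoord 0 3 (by decide)
  have h10 := hcoord 1 0 (by decide)
  have h12 := hcoord 1 2 (by decide)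
  have h13 := hcoord 1 3 (by decide)
  have h20 := hcoord 2 0 (by decide)
  have h21 := hcoord 2 1 (by decide)
  have h23 := hcoord 2 3 (by decide)
  have h30 := hcoord 3 0 (by decide)
  have h31 := hcoord 3 1 (by decide)
  have h32 := hcoord 3 2 (by decide)
  apply Set.Subset.antisymm
  · intro x hx
    obtain ⟨hx1, i, hi⟩ := (hmem x).1 hx
    rw [hr, B.convexHull_eq_nonneg_coord] at hx1
    have hi0 : B.coord i x = 0 := le_antisymm hi (hx1 i)
    have hsum := B.sum_coord_apply_eq_one x
    have hlin := B.linear_combination_coord_eq_self x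
    rw [Fin.sum_univ_four] at hsum hlin
    simp only [hBp] at hlin
    rw [← hlin]
    fin_cases i
    all_goals
      simp only [Fin.zero_eta, Fin.mk_one, Fin.reduceFinMk] at hi0
      simp only [hi0, zero_add, add_zero, zero_smul] at hsum ⊢
    · exact .inl (.inl (smul_add_smul_add_smul_mem_convexHull b c d (hx1 1) (hx1 2) (hx1 3) hsum))
    · exact .inl (.inr (smul_add_smul_add_smul_mem_convexHull a c d (hx1 0) (hx1 2) (hx1 3) hsum))
    · exact .inr (.inl (smul_add_smul_add_smul_mem_convexHull a b d (hx1 0) (hx1 1) (hx1 3) hsum))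
    · exact .inr (.inr (smul_add_smul_add_smul_mem_convexHull a b c (hx1 0) (hx1 1) (hx1 2) hsum))
  · refine Set.union_subset (Set.union_subset ?_ ?_) (Set.union_subset ?_ ?_)
    · refine hface 0 _ (by grind) ?_
      rintro p (rfl | rfl | rfl) <;> assumption
    · refine hface 1 _ (by grind) ?_
      rintro p (rfl | rfl | rfl) <;> assumption
    · refine hface 2 _ (by grind) ?_
      rintro p (rfl | rfl | rfl) <;> assumption
    · refine hface 3 _ (by grind) ?_
      rintro p (rfl | rfl | rfl) <;> assumption

/-- A point of a face meeting the centre `m` is joined to `m` by a segment in that face. -/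
theorem rho_le_of_mem_face {T : Set (EuclideanSpace ℝ (Fin 3))}
    {m y : EuclideanSpace ℝ (Fin 3)} {s : Set (EuclideanSpace ℝ (Fin 3))} {h : ℝ}
    (hT : convexHull ℝ s ⊆ T) (hm : m ∈ convexHull ℝ s) (hs : s ⊆ Metric.closedBall m h)
    (hy : y ∈ convexHull ℝ s) : rho T m y ≤ ENNReal.ofReal h := by
  refine (rho_le_edist_of_segment_subset
    (((convex_convexHull ℝ s).segment_subset hm hy).trans hT)).trans ?_
  rw [edist_dist, dist_comm]
  exact ENNReal.ofReal_le_ofReal (convexHull_min hs (convex_closedBall m h) hy)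

/-- A point of the face `a c d` of a thin tetrahedron is joined to the centre `m`, which lies on
the adjacent face `a b c`, by a path of two segments meeting on the edge `a c`. -/
theorem rho_le_of_mem_adjacent_face {T : Set (EuclideanSpace ℝ (Fin 3))}
    {a b c d m y : EuclideanSpace ℝ (Fin 3)} {h : ℝ}
    (habc : convexHull ℝ {a, b, c} ⊆ T) (hacd : convexHull ℝ {a, c, d} ⊆ T)
    (hm : m ∈ convexHull ℝ {a, b, c}) (ha : dist a m ≤ h)
    (hc : dist c m ≤ h / 6) (hd : dist d m ≤ h / 6)
    (hy : y ∈ convexHull ℝ {a, c, d}) : rho T m y ≤ ENNReal.ofReal h := by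
  have hh : 0 ≤ h := dist_nonneg.trans ha
  have key : ∀ p ∈ segment ℝ a c, dist m p + dist p y ≤ h → rho T m y ≤ ENNReal.ofReal h := by
    intro p hp hle
    have hpb : p ∈ convexHull ℝ {a, b, c} := segment_subset_convexHull (by simp) (by simp) hp
    have hpd : p ∈ convexHull ℝ {a, c, d} := segment_subset_convexHull (by simp) (by simp) hp
    calc rho T m y ≤ rho T m p + rho T p y := rho_triangle ..
      _ ≤ edist m p + edist p y := add_le_add
          (rho_le_edist_of_segment_subset
            (((convex_convexHull ℝ _).segment_subset hm hpb).trans habc))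
          (rho_le_edist_of_segment_subset
            (((convex_convexHull ℝ _).segment_subset hpd hy).trans hacd))
      _ = ENNReal.ofReal (dist m p + dist p y) := by
          rw [ENNReal.ofReal_add dist_nonneg dist_nonneg, edist_dist, edist_dist]
      _ ≤ ENNReal.ofReal h := ENNReal.ofReal_le_ofReal hle
  rw [convexHull_insert (by simp), convexHull_pair, mem_convexJoin] at hy
  obtain ⟨a', ha', k, hk, v, u, hv, hu, hvu, rfl⟩ := hy
  obtain rfl : a' = a := ha'
  have hkm : dist k m ≤ h / 6 :=
    (convex_closedBall m (h / 6)).segment_subset (by simpa using hc) (by simpa using hd) hk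
  rw [dist_eq_norm] at ha hc hkm
  obtain rfl : v = 1 - u := by linarith
  rcases le_total u (1 / 2) with hu2 | hu2
  · refine key ((1 - 2 * u) • a' + (2 * u) • c) ⟨_, _, by linarith, by linarith, by ring, rfl⟩ ?_
    have h1 : dist m ((1 - 2 * u) • a' + (2 * u) • c) ≤ (1 - 2 * u) * h + 2 * u * (h / 6) := by
      rw [dist_comm, dist_eq_norm,
        show (1 - 2 * u) • a' + (2 * u) • c - m = (1 - 2 * u) • (a' - m) + (2 * u) • (c - m) by
          module]
      refine (norm_add_le _ _).trans ?_
      rw [norm_smul, norm_smul, Real.norm_of_nonneg (by linarith), Real.norm_of_nonneg (by linarith)]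
      gcongr
      linarith
    have h2 : dist ((1 - 2 * u) • a' + (2 * u) • c) ((1 - u) • a' + u • k) ≤
        u * (h + 2 * (h / 6) + h / 6) := by
      rw [dist_comm, dist_eq_norm,
        show (1 - u) • a' + u • k - ((1 - 2 * u) • a' + (2 * u) • c) =
          u • ((a' - m) - (2 : ℝ) • (c - m) + (k - m)) by module, norm_smul, Real.norm_of_nonneg hu]
      gcongr
      refine (norm_add_le _ _).trans (add_le_add ((norm_sub_le _ _).trans ?_) hkm)
      rw [norm_smul, Real.norm_of_nonneg (by norm_num)]
      gcongr
    nlinarith [mul_nonneg hu hh]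
  · refine key c (right_mem_segment ℝ a' c) ?_
    have h2 : dist c ((1 - u) • a' + u • k) ≤ (1 - u) * h + u * (h / 6) + h / 6 := by
      rw [dist_comm, dist_eq_norm,
        show (1 - u) • a' + u • k - c = (1 - u) • (a' - m) + u • (k - m) - (c - m) by module]
      refine (norm_sub_le _ _).trans (add_le_add ((norm_add_le _ _).trans ?_) hc)
      rw [norm_smul, norm_smul, Real.norm_of_nonneg (by linarith), Real.norm_of_nonneg hu]
      gcongr
    rw [dist_comm m c, dist_eq_norm c m]
    nlinarith [mul_nonneg (sub_nonneg.2 hu2) hh]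

theorem rho_midpoint_le {a b c d : EuclideanSpace ℝ (Fin 3)}
    (hI : AffineIndependent ℝ ![a, b, c, d])
    (hc : c ∈ Metric.closedBall (midpoint ℝ a b) (1 / 12 * dist a b))
    (hd : d ∈ Metric.closedBall (midpoint ℝ a b) (1 / 12 * dist a b))
    {y : EuclideanSpace ℝ (Fin 3)} (hy : y ∈ frontier (convexHull ℝ {a, b, c, d})) :
    rho (frontier (convexHull ℝ {a, b, c, d})) (midpoint ℝ a b) y ≤ edist a b / 2 := by
  have hedist : edist a b / 2 = ENNReal.ofReal (dist a b / 2) := by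
    rw [edist_dist, ENNReal.ofReal_div_of_pos two_pos, ENNReal.ofReal_ofNat]
  rw [frontier_convexHull_tetrahedron hI] at hy ⊢
  rw [hedist]
  set T := convexHull ℝ {b, c, d} ∪ convexHull ℝ {a, c, d} ∪
        (convexHull ℝ {a, b, d} ∪ convexHull ℝ {a, b, c})
  have hbcdT : convexHull ℝ {b, c, d} ⊆ T := fun _ h => .inl (.inl h)
  have hacdT : convexHull ℝ {a, c, d} ⊆ T := fun _ h => .inl (.inr h)
  have habdT : convexHull ℝ {a, b, d} ⊆ T := fun _ h => .inr (.inl h)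
  have habcT : convexHull ℝ {a, b, c} ⊆ T := fun _ h => .inr (.inr h)
  have hmabd : midpoint ℝ a b ∈ convexHull ℝ {a, b, d} :=
    segment_subset_convexHull (by simp) (by simp) (midpoint_mem_segment a b)
  have hmabc : midpoint ℝ a b ∈ convexHull ℝ {a, b, c} :=
    segment_subset_convexHull (by simp) (by simp) (midpoint_mem_segment a b)
  have ha : dist a (midpoint ℝ a b) ≤ dist a b / 2 := by
    rw [dist_left_midpoint, Real.norm_ofNat]; linarith
  have hb : dist b (midpoint ℝ a b) ≤ dist a b / 2 := by
    rw [dist_right_midpoint, Real.norm_ofNat]; linarith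
  rw [Metric.mem_closedBall] at hc hd
  have h0 : 0 ≤ dist a b := dist_nonneg
  rcases hy with (hy | hy) | hy | hy
  · exact rho_le_of_mem_adjacent_face (a := b) (b := a) (by rwa [Set.insert_comm]) hbcdT
      (by rwa [Set.insert_comm]) hb (by linarith) (by linarith) hy
  · exact rho_le_of_mem_adjacent_face habcT hacdT hmabc ha (by linarith) (by linarith) hy
  · refine rho_le_of_mem_face habdT hmabd ?_ hy
    rintro p (rfl | rfl | rfl) <;> rw [Metric.mem_closedBall] <;> linarith
  · refine rho_le_of_mem_face habcT hmabc ?_ hy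
    rintro p (rfl | rfl | rfl) <;> rw [Metric.mem_closedBall] <;> linarith

theorem edist_div_two_le_intrinsicRad {T : Set (EuclideanSpace ℝ (Fin 3))}
    {a b : EuclideanSpace ℝ (Fin 3)} (ha : a ∈ T) (hb : b ∈ T) :
    edist a b / 2 ≤ intrinsicRad T := by
  refine le_iInf₂ fun x _ => ENNReal.div_le_of_le_mul ?_
  calc edist a b ≤ edist x a + edist x b := edist_triangle_left ..
    _ ≤ rho T x a + rho T x b := add_le_add (edist_le_rho T x a) (edist_le_rho T x b)
    _ ≤ (⨆ y ∈ T, rho T x y) + ⨆ y ∈ T, rho T x y :=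
      add_le_add (le_iSup₂_of_le a ha le_rfl) (le_iSup₂_of_le b hb le_rfl)
    _ = (⨆ y ∈ T, rho T x y) * 2 := (mul_two _).symm

theorem intrinsicDiam_le_of_rho_le {T : Set (EuclideanSpace ℝ (Fin 3))}
    {m : EuclideanSpace ℝ (Fin 3)} {r : ℝ≥0∞} (h : ∀ y ∈ T, rho T m y ≤ r) :
    intrinsicDiam T ≤ 2 * r := by
  refine iSup₂_le fun x hx => iSup₂_le fun y hy => ?_
  calc rho T x y ≤ rho T x m + rho T m y := rho_triangle ..
    _ ≤ r + r := add_le_add (rho_comm T x m ▸ h x hx) (h y hy)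
    _ = 2 * r := (two_mul r).symm

theorem stmt17 :
    ∃ ε₀ : ℝ, 0 < ε₀ ∧
      ∀ a b c d : EuclideanSpace ℝ (Fin 3),
        AffineIndependent ℝ ![a, b, c, d] →
        c ∈ Metric.closedBall (midpoint ℝ a b) (ε₀ * dist a b) →
        d ∈ Metric.closedBall (midpoint ℝ a b) (ε₀ * dist a b) →
        ⟪a - b, c - d⟫ = 0 →
        ⟪a - b, midpoint ℝ c d - midpoint ℝ a b⟫ = 0 →
        ⟪c - d, midpoint ℝ c d - midpoint ℝ a b⟫ = 0 →
        ∀ T : Set (EuclideanSpace ℝ (Fin 3)),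
          T = frontier (convexHull ℝ ({a, b, c, d} : Set (EuclideanSpace ℝ (Fin 3)))) →
          intrinsicRad T = edist a b / 2 ∧ intrinsicDiam T = 2 * intrinsicRad T := by
  refine ⟨1 / 12, by norm_num, fun a b c d hI hc hd _ _ _ T hT => ?_⟩
  have hcenter : ∀ y ∈ T, rho T (midpoint ℝ a b) y ≤ edist a b / 2 := by
    rw [hT]
    exact fun y hy => rho_midpoint_le hI hc hd hy
  have habc : convexHull ℝ {a, b, c} ⊆ T := by
    rw [hT, frontier_convexHull_tetrahedron hI]
    exact fun _ h => .inr (.inr h)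
  have ha : a ∈ T := habc (subset_convexHull ℝ _ (by simp))
  have hb : b ∈ T := habc (subset_convexHull ℝ _ (by simp))
  have hm : midpoint ℝ a b ∈ T :=
    habc (segment_subset_convexHull (by simp) (by simp) (midpoint_mem_segment a b))
  have hrad : intrinsicRad T = edist a b / 2 :=
    (iInf₂_le_of_le _ hm (iSup₂_le hcenter)).antisymm (edist_div_two_le_intrinsicRad ha hb)
  refine ⟨hrad, hrad ▸ (intrinsicDiam_le_of_rho_le hcenter).antisymm ?_⟩
  rw [ENNReal.mul_div_cancel (by norm_num) (by norm_num)]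
  exact (edist_le_rho T a b).trans (le_iSup₂_of_le a ha (le_iSup₂_of_le b hb le_rfl))
end

section
/- Let a tetrahedron have [a b] as a longest edge (dist a b is greater than or equal to each of the other five pairwise distances among the vertices), and let o = midpoint ℝ a b. Then every point of the surface is at intrinsic distance at most dist a b from o: for every y ∈ T, ρ(o, y) ≤ dist a b. -/
open scoped ENNReal

theorem rho_le_edist_add_edist {T : Set (EuclideanSpace ℝ (Fin 3))}
    {x m z : EuclideanSpace ℝ (Fin 3)} (hxm : segment ℝ x m ⊆ T) (hmz : segment ℝ m z ⊆ T) :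
    rho T x z ≤ edist x m + edist m z := by
  let f : ℝ → EuclideanSpace ℝ (Fin 3) := fun t =>
    if t ≤ 1 / 2 then AffineMap.lineMap x m (2 * t) else AffineMap.lineMap m z (2 * t - 1)
  have hleft : ∀ t ≤ (1 / 2 : ℝ), f t = AffineMap.lineMap x m (2 * t) := fun t ht => if_pos ht
  have hright : ∀ t, (1 / 2 : ℝ) ≤ t → f t = AffineMap.lineMap m z (2 * t - 1) := by
    intro t ht
    rcases ht.eq_or_lt with rfl | ht
    · rw [hleft _ le_rfl]; norm_num
    · exact if_neg (not_le.2 ht)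
  have hcont : Continuous f := by
    refine Continuous.if_le (AffineMap.lineMap_continuous.comp (by fun_prop))
      (AffineMap.lineMap_continuous.comp (by fun_prop)) continuous_id continuous_const ?_
    rintro t rfl
    norm_num
  have hmem : ∀ t ∈ Set.Icc (0 : ℝ) 1, f t ∈ T := by
    rintro t ⟨h0, h1⟩
    rcases le_total t (1 / 2) with ht | ht
    · rw [hleft t ht]
      exact hxm (segment_eq_image_lineMap ℝ x m ▸ ⟨2 * t, ⟨by linarith, by linarith⟩, rfl⟩)
    · rw [hright t ht]
      exact hmz (segment_eq_image_lineMap ℝ m z ▸ ⟨2 * t - 1, ⟨by linarith, by linarith⟩, rfl⟩)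
  have hline : ∀ (p q : EuclideanSpace ℝ (Fin 3)) (g : ℝ → ℝ) (u v : ℝ), Monotone g → u ≤ v →
      g v - g u = 1 →
      eVariationOn (fun t => (AffineMap.lineMap p q (g t) : EuclideanSpace ℝ (Fin 3)))
        (Set.Icc u v) ≤ edist p q := by
    intro p q g u v hg huv hguv
    have h := (lipschitzWith_lineMap (𝕜 := ℝ) p q).lipschitzOnWith (s := Set.univ)
      |>.comp_eVariationOn_le (g := g) (s := Set.Icc u v) (Set.mapsTo_univ _ _)
    refine h.trans ?_
    have h2 := (hg.monotoneOn (Set.Icc u v)).eVariationOn_eq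
      (Set.left_mem_Icc.2 huv) (Set.right_mem_Icc.2 huv)
    rw [Set.inter_self, hguv, ENNReal.ofReal_one] at h2
    calc _ ≤ (nndist p q : ℝ≥0∞) * 1 := by gcongr; exact h2.le
      _ = edist p q := by rw [mul_one, edist_nndist]
  have h0 : f 0 = x := by rw [hleft 0 (by norm_num)]; simp
  have h1 : f 1 = z := by rw [hright 1 (by norm_num)]; norm_num
  unfold rho
  refine iInf_le_of_le f <| iInf_le_of_le hcont <| iInf_le_of_le h0 <| iInf_le_of_le h1 <|
    iInf_le_of_le hmem ?_
  have hsplit := eVariationOn.Icc_add_Icc f (s := Set.univ) (a := (0 : ℝ)) (b := 1 / 2) (c := 1)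
    (by norm_num) (by norm_num) (Set.mem_univ _)
  simp only [Set.univ_inter] at hsplit
  rw [← hsplit]
  gcongr
  · rw [eVariationOn.congr (f := f) (g := fun t => AffineMap.lineMap x m (2 * t))
      fun t ht => hleft t ht.2]
    exact hline x m (fun t => 2 * t) _ _ (fun s t h => by dsimp only; linarith) (by norm_num)
      (by norm_num)
  · rw [eVariationOn.congr (f := f) (g := fun t => AffineMap.lineMap m z (2 * t - 1))
      fun t ht => hright t ht.1]
    exact hline m z (fun t => 2 * t - 1) _ _ (fun s t h => by dsimp only; linarith) (by norm_num)
      (by norm_num)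

section Thales

variable {V : Type*} [NormedAddCommGroup V] [InnerProductSpace ℝ V]

theorem dist_midpoint_le_of_inner_nonpos {p q y : V} (h : inner ℝ (p - y) (q - y) ≤ 0) :
    dist (midpoint ℝ p q) y ≤ dist p q / 2 := by
  have h1 : midpoint ℝ p q - y = (2⁻¹ : ℝ) • ((p - y) + (q - y)) := by
    rw [midpoint_eq_smul_add, invOf_eq_inv]; module
  have h2 : p - q = (p - y) - (q - y) := by abel
  have h3 := norm_add_sq_real (p - y) (q - y)
  have h4 := norm_sub_sq_real (p - y) (q - y)
  have h5 : ‖(p - y) + (q - y)‖ ≤ ‖(p - y) - (q - y)‖ :=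
    le_of_sq_le_sq (by linarith) (norm_nonneg _)
  rw [dist_eq_norm, dist_eq_norm, h1, h2, norm_smul, Real.norm_of_nonneg (by norm_num)]
  linarith

/-- The disks whose diameters are two sides of a triangle cover the triangle. -/
theorem dist_midpoint_le_or_dist_midpoint_le {p q r y : V} {α β γ : ℝ} (hα : 0 ≤ α) (hβ : 0 ≤ β)
    (hγ : 0 ≤ γ) (hsum : α + β + γ = 1) (hy : y = α • p + β • q + γ • r) :
    dist (midpoint ℝ p q) y ≤ dist p q / 2 ∨ dist (midpoint ℝ p r) y ≤ dist p r / 2 := by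
  by_contra! hcon
  have hq : 0 < inner ℝ (p - y) (q - y) := by
    by_contra! h; exact hcon.1.not_ge (dist_midpoint_le_of_inner_nonpos h)
  have hr : 0 < inner ℝ (p - y) (r - y) := by
    by_contra! h; exact hcon.2.not_ge (dist_midpoint_le_of_inner_nonpos h)
  have hp : 0 < inner ℝ (p - y) (p - y) := by
    rw [real_inner_self_eq_norm_sq]
    refine pow_pos (norm_pos_iff.2 fun h => ?_) 2
    simp [h] at hq
  have hzero : α • (p - y) + β • (q - y) + γ • (r - y) = 0 := by
    have : α • (p - y) + β • (q - y) + γ • (r - y)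
        = (α • p + β • q + γ • r) - (α + β + γ) • y := by module
    rw [this, hsum, one_smul, ← hy, sub_self]
  have h := congrArg (inner ℝ (p - y)) hzero
  simp only [inner_add_right, inner_smul_right, inner_zero_right] at h
  have h1 := mul_nonneg hα hp.le
  have h2 := mul_nonneg hβ hq.le
  have h3 := mul_nonneg hγ hr.le
  have hα0 : α = 0 :=
    (mul_eq_zero.1 (by linarith : α * inner ℝ (p - y) (p - y) = 0)).resolve_right hp.ne'
  have hβ0 : β = 0 :=
    (mul_eq_zero.1 (by linarith : β * inner ℝ (p - y) (q - y) = 0)).resolve_right hq.ne'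
  have hγ0 : γ = 0 :=
    (mul_eq_zero.1 (by linarith : γ * inner ℝ (p - y) (r - y) = 0)).resolve_right hr.ne'
  linarith

end Thales

/-- The points of a simplex with `i`-th barycentric coordinate zero. -/
def AffineBasis.face {ι V : Type*} [NormedAddCommGroup V] [NormedSpace ℝ V]
    (B : AffineBasis ι ℝ V) (i : ι) : Set V :=
  {x | (∀ j, 0 ≤ B.coord j x) ∧ B.coord i x = 0}

section Face

variable {ι V : Type*} [NormedAddCommGroup V] [NormedSpace ℝ V] (B : AffineBasis ι ℝ V)

theorem AffineBasis.convex_face (i : ι) : Convex ℝ (B.face i) := by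
  intro x hx y hy s t hs ht hst
  have hcomb : ∀ j, B.coord j (s • x + t • y) = s * B.coord j x + t * B.coord j y := fun j =>
    Convex.combo_affine_apply hst
  refine ⟨fun j => ?_, ?_⟩
  · rw [hcomb]
    exact add_nonneg (mul_nonneg hs (hx.1 j)) (mul_nonneg ht (hy.1 j))
  · rw [hcomb, hx.2, hy.2]; simp

theorem AffineBasis.apply_mem_face {i j : ι} (h : i ≠ j) : B j ∈ B.face i :=
  ⟨fun k => by
    classical
    rw [B.coord_apply]; split_ifs <;> norm_num, B.coord_apply_ne h⟩

theorem AffineBasis.frontier_convexHull_eq_iUnion_face [Finite ι] :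
    frontier (convexHull ℝ (Set.range B)) = ⋃ i, B.face i := by
  have hclosed : IsClosed (convexHull ℝ (Set.range B)) :=
    (Set.finite_range B).isClosed_convexHull ℝ
  rw [hclosed.frontier_eq, B.interior_convexHull, B.convexHull_eq_nonneg_coord]
  ext x
  simp only [Set.mem_sdiff, Set.mem_ofPred_eq, Set.mem_iUnion, AffineBasis.face, not_forall, not_lt]
  constructor
  · rintro ⟨h, i, hi⟩
    exact ⟨i, h, le_antisymm hi (h i)⟩
  · rintro ⟨i, h, hi⟩
    exact ⟨h, i, hi.le⟩

end Face

/-- A surface point on the triangle `p r s` opposite `q` is close to the midpoint of `p q`,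
by a path crossing `p r` or `p s` at its midpoint. -/
theorem rho_midpoint_le_of_mem_triangle {T : Set (EuclideanSpace ℝ (Fin 3))}
    {p q r s y : EuclideanSpace ℝ (Fin 3)} {α β γ : ℝ} (hα : 0 ≤ α) (hβ : 0 ≤ β)
    (hγ : 0 ≤ γ) (hsum : α + β + γ = 1) (hy : y = α • p + β • r + γ • s)
    (hpr : dist p r ≤ dist p q) (hps : dist p s ≤ dist p q)
    (hqr : dist q r ≤ dist p q) (hqs : dist q s ≤ dist p q)
    (hr : segment ℝ (midpoint ℝ p q) (midpoint ℝ p r) ⊆ T)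
    (hs : segment ℝ (midpoint ℝ p q) (midpoint ℝ p s) ⊆ T)
    (hry : segment ℝ (midpoint ℝ p r) y ⊆ T) (hsy : segment ℝ (midpoint ℝ p s) y ⊆ T) :
    rho T (midpoint ℝ p q) y ≤ edist p q := by
  have key : ∀ v, dist q v ≤ dist p q → dist (midpoint ℝ p v) y ≤ dist p q / 2 →
      edist (midpoint ℝ p q) (midpoint ℝ p v) + edist (midpoint ℝ p v) y ≤ edist p q := by
    intro v hv hvy
    have h := dist_midpoint_midpoint_le p q p v
    rw [dist_self] at h
    rw [edist_dist, edist_dist, edist_dist, ← ENNReal.ofReal_add dist_nonneg dist_nonneg]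
    exact ENNReal.ofReal_le_ofReal (by linarith)
  rcases dist_midpoint_le_or_dist_midpoint_le hα hβ hγ hsum hy with h | h
  · exact (rho_le_edist_add_edist hr hry).trans (key r hqr (by linarith))
  · exact (rho_le_edist_add_edist hs hsy).trans (key s hqs (by linarith))

theorem stmt18 (a b c d : EuclideanSpace ℝ (Fin 3))
    (hind : AffineIndependent ℝ ![a, b, c, d])
    (hac : dist a c ≤ dist a b) (had : dist a d ≤ dist a b)
    (hbc : dist b c ≤ dist a b) (hbd : dist b d ≤ dist a b)
    (hcd : dist c d ≤ dist a b)
    (T : Set (EuclideanSpace ℝ (Fin 3)))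
    (hT : T = frontier (convexHull ℝ ({a, b, c, d} : Set (EuclideanSpace ℝ (Fin 3))))) :
    ∀ y ∈ T, rho T (midpoint ℝ a b) y ≤ edist a b := by
  have hfin : Module.finrank ℝ (EuclideanSpace ℝ (Fin 3)) = 3 := by simp
  have htot : affineSpan ℝ (Set.range ![a, b, c, d]) = ⊤ :=
    hind.affineSpan_eq_top_iff_card_eq_finrank_add_one.2 (by simp)
  obtain ⟨B, hB⟩ : ∃ B : AffineBasis (Fin 4) ℝ (EuclideanSpace ℝ (Fin 3)),
      (B : Fin 4 → EuclideanSpace ℝ (Fin 3)) = ![a, b, c, d] :=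
    ⟨⟨![a, b, c, d], hind, htot⟩, rfl⟩
  have hBa : B 0 = a := by rw [hB]; rfl
  have hBb : B 1 = b := by rw [hB]; rfl
  have hBc : B 2 = c := by rw [hB]; rfl
  have hBd : B 3 = d := by rw [hB]; rfl
  have hrange : Set.range B = {a, b, c, d} := by
    simp only [hB, Matrix.range_cons, Matrix.range_empty, Set.union_empty, Set.singleton_union]
  rw [← hrange, B.frontier_convexHull_eq_iUnion_face] at hT
  have hface : ∀ i, B.face i ⊆ T := fun i => hT ▸ Set.subset_iUnion _ i
  have ha : ∀ i, i ≠ 0 → a ∈ B.face i :=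
    fun i hi => hBa ▸ B.apply_mem_face hi
  have hb : ∀ i, i ≠ 1 → b ∈ B.face i :=
    fun i hi => hBb ▸ B.apply_mem_face hi
  have hc : ∀ i, i ≠ 2 → c ∈ B.face i :=
    fun i hi => hBc ▸ B.apply_mem_face hi
  have hd : ∀ i, i ≠ 3 → d ∈ B.face i :=
    fun i hi => hBd ▸ B.apply_mem_face hi
  have hseg : ∀ i u v, u ∈ B.face i → v ∈ B.face i → segment ℝ u v ⊆ T := fun i u v hu hv =>
    ((B.convex_face i).segment_subset hu hv).trans (hface i)
  have hmid : ∀ i u v, u ∈ B.face i → v ∈ B.face i → midpoint ℝ u v ∈ B.face i :=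
    fun i u v hu hv => (B.convex_face i).midpoint_mem hu hv
  intro y hy
  obtain ⟨i, hyi⟩ := Set.mem_iUnion.1 (hT ▸ hy)
  have hsum := B.sum_coord_apply_eq_one y
  have hcomb : B.coord 0 y • a + B.coord 1 y • b + B.coord 2 y • c + B.coord 3 y • d = y := by
    have h := B.linear_combination_coord_eq_self y
    rwa [Fin.sum_univ_four, hBa, hBb, hBc, hBd] at h
  rw [Fin.sum_univ_four] at hsum
  have hdirect : midpoint ℝ a b ∈ B.face i → rho T (midpoint ℝ a b) y ≤ edist a b := by
    intro ho
    have h := rho_le_edist_add_edist (hseg i _ _ ho hyi)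
      (hseg i _ _ hyi hyi)
    rw [edist_self, add_zero] at h
    refine h.trans ?_
    have hball : ∀ v, dist a v ≤ dist a b → dist b v ≤ dist a b →
        v ∈ Metric.closedBall (midpoint ℝ a b) (dist a b) := by
      intro v hav hbv
      rw [Metric.mem_closedBall, dist_comm]
      exact (convex_closedBall v (dist a b)).midpoint_mem hav hbv
    have hyball : y ∈ Metric.closedBall (midpoint ℝ a b) (dist a b) := by
      refine convexHull_min (s := {a, b, c, d}) ?_ (convex_closedBall _ _) ?_
      · rintro v (rfl | rfl | rfl | rfl)
        · exact hball _ (by simp) (by rw [dist_comm])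
        · exact hball _ le_rfl (by simp)
        · exact hball _ hac hbc
        · exact hball _ had hbd
      · rw [← hrange, B.convexHull_eq_nonneg_coord]
        exact hyi.1
    rw [edist_dist, edist_dist, dist_comm]
    exact ENNReal.ofReal_le_ofReal hyball
  have ho2 : midpoint ℝ a b ∈ B.face 2 := hmid 2 a b (ha 2 (by decide)) (hb 2 (by decide))
  have ho3 : midpoint ℝ a b ∈ B.face 3 := hmid 3 a b (ha 3 (by decide)) (hb 3 (by decide))
  obtain rfl | rfl | rfl | rfl : i = 0 ∨ i = 1 ∨ i = 2 ∨ i = 3 := by omega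
  · have h0 : B.coord 0 y = 0 := hyi.2
    rw [h0, zero_add] at hsum
    rw [h0, zero_smul, zero_add] at hcomb
    rw [midpoint_comm, edist_comm]
    rw [midpoint_comm] at ho2 ho3
    rw [dist_comm a b] at hac had hbc hbd
    exact rho_midpoint_le_of_mem_triangle (hyi.1 1) (hyi.1 2) (hyi.1 3) hsum hcomb.symm
      hbc hbd hac had
      (hseg 3 _ _ ho3 (hmid 3 b c (hb 3 (by decide)) (hc 3 (by decide))))
      (hseg 2 _ _ ho2 (hmid 2 b d (hb 2 (by decide)) (hd 2 (by decide))))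
      (hseg 0 _ _ (hmid 0 b c (hb 0 (by decide)) (hc 0 (by decide))) hyi)
      (hseg 0 _ _ (hmid 0 b d (hb 0 (by decide)) (hd 0 (by decide))) hyi)
  · have h1 : B.coord 1 y = 0 := hyi.2
    rw [h1, add_zero] at hsum
    rw [h1, zero_smul, add_zero] at hcomb
    exact rho_midpoint_le_of_mem_triangle (hyi.1 0) (hyi.1 2) (hyi.1 3) hsum hcomb.symm
      hac had hbc hbd
      (hseg 3 _ _ ho3 (hmid 3 a c (ha 3 (by decide)) (hc 3 (by decide))))
      (hseg 2 _ _ ho2 (hmid 2 a d (ha 2 (by decide)) (hd 2 (by decide))))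
      (hseg 1 _ _ (hmid 1 a c (ha 1 (by decide)) (hc 1 (by decide))) hyi)
      (hseg 1 _ _ (hmid 1 a d (ha 1 (by decide)) (hd 1 (by decide))) hyi)
  · exact hdirect ho2
  · exact hdirect ho3
end
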